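/- arXiv:1210.8051 — 3 statements merged into one kernel-verified Lean document; each statement's English description precedes it below -/
import Mathlib

section
/- For all a ≥ b > 0 and p > 0, ∫₀^∞ (τ/(τ² + p²)) J₁(aτ) J₁(bτ) dτ = K₁(ap) I₁(bp), where J₁ is the Bessel function of the first kind of order 1, and I₁, K₁ are the modified Bessel functions of the first and second kind of order 1. -/
open MeasureTheory Filter

/-- Bessel function of the first kind of order `k` (integral representation). -/
noncomputable def besselJ (k : ℕ) (r : ℝ) : ℝ :=
  (r / 2) ^ k / (Real.sqrt Real.pi * Real.Gamma ((k : ℝ) + 1 / 2)) *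
    ∫ θ in (0:ℝ)..Real.pi, Real.cos (r * Real.cos θ) * Real.sin θ ^ (2 * k)

/-- Modified Bessel function of the first kind of order `k`. -/
noncomputable def besselI (k : ℕ) (r : ℝ) : ℝ :=
  (r / 2) ^ k / (Real.sqrt Real.pi * Real.Gamma ((k : ℝ) + 1 / 2)) *
    ∫ θ in (0:ℝ)..Real.pi, Real.exp (r * Real.cos θ) * Real.sin θ ^ (2 * k)

/-- Modified Bessel function of the second kind of order `k`. -/
noncomputable def besselK (k : ℕ) (r : ℝ) : ℝ :=
  ∫ t in Set.Ioi (0:ℝ), Real.exp (-(r * Real.cosh t)) * Real.cosh ((k : ℝ) * t)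

lemma sqrt_pi_mul_Gamma_three_halves :
    Real.sqrt Real.pi * Real.Gamma (((1 : ℕ) : ℝ) + 1 / 2) = Real.pi / 2 := by
  rw [Nat.cast_one, add_comm, Real.Gamma_add_one (by norm_num), Real.Gamma_one_half_eq]
  linear_combination 2⁻¹ * Real.mul_self_sqrt Real.pi_pos.le

lemma besselJ_one_eq (r : ℝ) :
    besselJ 1 r = Real.pi⁻¹ * ∫ θ in (0:ℝ)..Real.pi, Real.sin (r * Real.cos θ) * Real.cos θ := by
  have hparts := intervalIntegral.integral_mul_deriv_eq_deriv_mul (a := 0) (b := Real.pi)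
    (u := Real.sin) (u' := Real.cos) (v := fun θ => -Real.sin (r * Real.cos θ))
    (v' := fun θ => r * (Real.cos (r * Real.cos θ) * Real.sin θ))
    (fun θ _ => Real.hasDerivAt_sin θ)
    (fun θ _ => (((Real.hasDerivAt_cos θ).const_mul r).sin).fun_neg.congr_deriv (by ring))
    (by apply Continuous.intervalIntegrable; fun_prop)
    (by apply Continuous.intervalIntegrable; fun_prop)
  rw [besselJ, sqrt_pi_mul_Gamma_three_halves]
  have hpi0 := Real.pi_pos.ne'
  have : r * ∫ θ in (0:ℝ)..Real.pi, Real.cos (r * Real.cos θ) * Real.sin θ ^ (2 * 1)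
      = ∫ θ in (0:ℝ)..Real.pi, Real.sin (r * Real.cos θ) * Real.cos θ := by
    rw [← intervalIntegral.integral_const_mul]
    simp only [Real.sin_pi, Real.sin_zero, zero_mul, sub_zero, zero_sub] at hparts
    rw [← intervalIntegral.integral_neg] at hparts
    refine (Eq.trans ?_ hparts).trans ?_ <;>
    · refine intervalIntegral.integral_congr fun θ _ => ?_
      ring
  rw [← this]
  field_simp

lemma besselI_one_eq (r : ℝ) :
    besselI 1 r = Real.pi⁻¹ * ∫ θ in (0:ℝ)..Real.pi, Real.sinh (r * Real.cos θ) * Real.cos θ := by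
  have hparts := intervalIntegral.integral_mul_deriv_eq_deriv_mul (a := 0) (b := Real.pi)
    (u := Real.sin) (u' := Real.cos) (v := fun θ => -Real.exp (r * Real.cos θ))
    (v' := fun θ => r * (Real.exp (r * Real.cos θ) * Real.sin θ))
    (fun θ _ => Real.hasDerivAt_sin θ)
    (fun θ _ => (((Real.hasDerivAt_cos θ).const_mul r).exp).fun_neg.congr_deriv (by ring))
    (by apply Continuous.intervalIntegrable; fun_prop)
    (by apply Continuous.intervalIntegrable; fun_prop)
  rw [besselI, sqrt_pi_mul_Gamma_three_halves]
  have hpi0 := Real.pi_pos.ne'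
  have hexp : r * ∫ θ in (0:ℝ)..Real.pi, Real.exp (r * Real.cos θ) * Real.sin θ ^ (2 * 1)
      = ∫ θ in (0:ℝ)..Real.pi, Real.exp (r * Real.cos θ) * Real.cos θ := by
    rw [← intervalIntegral.integral_const_mul]
    simp only [Real.sin_pi, Real.sin_zero, zero_mul, sub_zero, zero_sub] at hparts
    rw [← intervalIntegral.integral_neg] at hparts
    refine (Eq.trans ?_ hparts).trans ?_ <;>
    · refine intervalIntegral.integral_congr fun θ _ => ?_
      ring
  have hrefl : ∫ θ in (0:ℝ)..Real.pi, Real.exp (r * Real.cos θ) * Real.cos θ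
      = ∫ θ in (0:ℝ)..Real.pi, -(Real.exp (-(r * Real.cos θ)) * Real.cos θ) := by
    have := intervalIntegral.integral_comp_sub_left (a := 0) (b := Real.pi)
      (fun θ => Real.exp (r * Real.cos θ) * Real.cos θ) Real.pi
    simp only [sub_self, sub_zero, Real.cos_pi_sub, mul_neg] at this
    exact this.symm
  have hsinh : ∫ θ in (0:ℝ)..Real.pi, Real.sinh (r * Real.cos θ) * Real.cos θ
      = ∫ θ in (0:ℝ)..Real.pi, Real.exp (r * Real.cos θ) * Real.cos θ := by
    have hadd := intervalIntegral.integral_add (μ := volume) (a := 0) (b := Real.pi)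
      (f := fun θ => Real.exp (r * Real.cos θ) * Real.cos θ)
      (g := fun θ => -(Real.exp (-(r * Real.cos θ)) * Real.cos θ))
      (by apply Continuous.intervalIntegrable; fun_prop)
      (by apply Continuous.intervalIntegrable; fun_prop)
    rw [← hrefl] at hadd
    have : ∫ θ in (0:ℝ)..Real.pi, Real.sinh (r * Real.cos θ) * Real.cos θ
        = 2⁻¹ * ∫ θ in (0:ℝ)..Real.pi, (Real.exp (r * Real.cos θ) * Real.cos θ
          + -(Real.exp (-(r * Real.cos θ)) * Real.cos θ)) := by
      rw [← intervalIntegral.integral_const_mul]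
      congr 1
      funext θ
      rw [Real.sinh_eq]
      ring
    rw [this, hadd]
    ring
  rw [hsinh, ← hexp]
  field_simp

lemma continuous_besselJ_one : Continuous (besselJ 1) := by
  have : besselJ 1 = fun r => Real.pi⁻¹ *
      ∫ θ in (0:ℝ)..Real.pi, Real.sin (r * Real.cos θ) * Real.cos θ :=
    funext besselJ_one_eq
  rw [this]
  refine continuous_const.mul
    (intervalIntegral.continuous_parametric_intervalIntegral_of_continuous' ?_ _ _)
  unfold Function.uncurry
  fun_prop

lemma abs_besselJ_one_le_one (r : ℝ) : |besselJ 1 r| ≤ 1 := by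
  have h := intervalIntegral.norm_integral_le_of_norm_le_const (a := 0) (b := Real.pi) (C := 1)
    (f := fun θ => Real.sin (r * Real.cos θ) * Real.cos θ) (fun θ _ => by
      rw [norm_mul]
      exact mul_le_one₀ (Real.abs_sin_le_one _) (norm_nonneg _) (Real.abs_cos_le_one _))
  rw [sub_zero, abs_of_pos Real.pi_pos, one_mul, Real.norm_eq_abs] at h
  rw [besselJ_one_eq, abs_mul, abs_of_pos (inv_pos.2 Real.pi_pos), inv_mul_le_iff₀ Real.pi_pos,
    mul_one]
  exact h

lemma add_ofReal_mem_slitPlane {w : ℂ} (hw : w ∈ Complex.slitPlane) {y : ℝ} (hy : 0 ≤ y) :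
    w + y ∈ Complex.slitPlane := by
  rw [Complex.mem_slitPlane_iff] at hw ⊢
  rcases hw with h | h
  · left; simp; linarith
  · right; simpa using h

lemma integral_inv_add_sq_mul_cos_sq {w : ℂ} (hw : w ∈ Complex.slitPlane) (a : ℝ) :
    (∫ θ in (0:ℝ)..Real.pi, (w + (a ^ 2 * Real.cos θ ^ 2 : ℝ))⁻¹) * (w + (a ^ 2 : ℝ)) ^ (1 / 2 : ℂ)
      = Real.pi * w⁻¹ * w ^ (1 / 2 : ℂ) := by
  have hD : ∀ y θ : ℝ, w + (y ^ 2 * Real.cos θ ^ 2 : ℝ) ≠ 0 := fun y θ =>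
    Complex.slitPlane_ne_zero (add_ofReal_mem_slitPlane hw (by positivity))
  have hS : ∀ y : ℝ, w + (y ^ 2 : ℝ) ∈ Complex.slitPlane := fun y =>
    add_ofReal_mem_slitPlane hw (by positivity)
  set D' : ℝ → ℝ → ℂ := fun y θ =>
    -((2 * y * Real.cos θ ^ 2 : ℝ) : ℂ) / (w + (y ^ 2 * Real.cos θ ^ 2 : ℝ)) ^ 2 with hD'
  have hD'c : Continuous (Function.uncurry D') := by
    simp only [hD', Function.uncurry_def]
    refine Continuous.div (by fun_prop) (by fun_prop) fun x => pow_ne_zero 2 (hD _ _)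
  have hinvc : ∀ y : ℝ, Continuous fun θ : ℝ => (w + (y ^ 2 * Real.cos θ ^ 2 : ℝ))⁻¹ := fun y =>
    Continuous.inv₀ (by fun_prop) (hD y)
  set F : ℝ → ℂ := fun y => ∫ θ in (0:ℝ)..Real.pi, (w + (y ^ 2 * Real.cos θ ^ 2 : ℝ))⁻¹ with hF
  have hFderiv : ∀ y, HasDerivAt F (∫ θ in (0:ℝ)..Real.pi, D' y θ) y := by
    intro y
    obtain ⟨C, hC⟩ := ((isCompact_closedBall y 1).prod
      (isCompact_Icc (a := (0:ℝ)) (b := Real.pi))).exists_bound_of_continuousOn hD'c.continuousOn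
    refine (intervalIntegral.hasDerivAt_integral_of_dominated_loc_of_deriv_le
      (bound := fun _ => C) (F' := D') (Metric.closedBall_mem_nhds y one_pos)
      (Eventually.of_forall fun x => (hinvc x).aestronglyMeasurable)
      ((hinvc y).intervalIntegrable _ _)
      (hD'c.comp (by fun_prop : Continuous fun θ : ℝ => (y, θ))).aestronglyMeasurable
      (Eventually.of_forall fun θ hθ x hx => hC (x, θ) ⟨hx, ?_⟩)
      intervalIntegrable_const (Eventually.of_forall fun θ _ x _ => ?_)).2
    · rw [Set.uIoc_of_le Real.pi_pos.le] at hθ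
      exact ⟨hθ.1.le, hθ.2⟩
    · have h1 : HasDerivAt (fun x : ℝ => x ^ 2 * Real.cos θ ^ 2) (2 * x * Real.cos θ ^ 2) x := by
        simpa using (hasDerivAt_pow 2 x).mul_const (Real.cos θ ^ 2)
      exact (h1.ofReal_comp.const_add w).inv (hD x θ)
  have hrel : ∀ y : ℝ, (w + (y ^ 2 : ℝ)) * (∫ θ in (0:ℝ)..Real.pi, D' y θ) = -y * F y := by
    intro y
    have hderiv : ∀ θ ∈ Set.uIcc 0 Real.pi, HasDerivAt
        (fun θ : ℝ => (y : ℂ) * ((Real.sin θ * Real.cos θ : ℝ) : ℂ)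
          / (w + (y ^ 2 * Real.cos θ ^ 2 : ℝ)))
        (-((w + (y ^ 2 : ℝ)) * D' y θ + y * (w + (y ^ 2 * Real.cos θ ^ 2 : ℝ))⁻¹)) θ := by
      intro θ _
      have h1 : HasDerivAt (fun θ : ℝ => Real.sin θ * Real.cos θ)
          (2 * Real.cos θ ^ 2 - 1) θ := by
        refine ((Real.hasDerivAt_sin θ).fun_mul (Real.hasDerivAt_cos θ)).congr_deriv ?_
        linear_combination -Real.sin_sq_add_cos_sq θ
      have h2 : HasDerivAt (fun θ : ℝ => y ^ 2 * Real.cos θ ^ 2)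
          (-(2 * y ^ 2 * (Real.sin θ * Real.cos θ))) θ := by
        refine (((Real.hasDerivAt_cos θ).fun_pow 2).const_mul (y ^ 2)).congr_deriv ?_
        push_cast
        ring
      refine ((h1.ofReal_comp.const_mul (y : ℂ)).fun_div (h2.ofReal_comp.const_add w)
        (hD y θ)).congr_deriv ?_
      have hs : (Real.sin θ : ℂ) ^ 2 = 1 - (Real.cos θ : ℂ) ^ 2 := by
        have := Real.sin_sq θ
        exact_mod_cast this
      have h0 := hD y θ
      simp only [hD']
      rw [div_eq_iff (pow_ne_zero 2 h0)]
      push_cast at hs h0 ⊢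
      field_simp
      linear_combination (2 * y ^ 3 * Complex.cos θ ^ 2) * hs
    have hcont1 : Continuous fun θ : ℝ => (w + (y ^ 2 : ℝ)) * D' y θ :=
      continuous_const.mul (hD'c.comp (by fun_prop : Continuous fun θ : ℝ => (y, θ)))
    have hcont2 : Continuous fun θ : ℝ => (y : ℂ) * (w + (y ^ 2 * Real.cos θ ^ 2 : ℝ))⁻¹ :=
      continuous_const.mul (hinvc y)
    have h := intervalIntegral.integral_eq_sub_of_hasDerivAt hderiv
      ((hcont1.add hcont2).neg.intervalIntegrable _ _)
    rw [intervalIntegral.integral_neg, intervalIntegral.integral_add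
      (hcont1.intervalIntegrable _ _) (hcont2.intervalIntegrable _ _),
      intervalIntegral.integral_const_mul, intervalIntegral.integral_const_mul] at h
    simp only [Real.sin_pi, Real.sin_zero, zero_mul, Complex.ofReal_zero, mul_zero, zero_div,
      sub_zero] at h
    linear_combination -h
  have hGderiv : ∀ y, HasDerivAt (fun y : ℝ => F y * (w + (y ^ 2 : ℝ)) ^ (1 / 2 : ℂ)) 0 y := by
    intro y
    have h1 : HasDerivAt (fun y : ℝ => w + ((y ^ 2 : ℝ) : ℂ)) ((2 * y : ℝ) : ℂ) y := by
      have : HasDerivAt (fun y : ℝ => y ^ 2) (2 * y) y := by simpa using hasDerivAt_pow 2 y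
      exact this.ofReal_comp.const_add w
    have h2 : HasDerivAt (fun z : ℂ => z ^ (1 / 2 : ℂ)) _ (w + ((y ^ 2 : ℝ) : ℂ)) :=
      (hasDerivAt_id _).cpow_const (c := (1 / 2 : ℂ)) (hS y)
    refine ((hFderiv y).fun_mul (h2.comp y h1)).congr_deriv ?_
    simp only [Function.comp_apply, id_eq]
    have h0 := Complex.slitPlane_ne_zero (hS y)
    rw [Complex.cpow_sub _ _ h0, Complex.cpow_one]
    have := hrel y
    field_simp
    push_cast at this ⊢
    linear_combination (2 * (w + (y : ℂ) ^ 2) ^ (1 / 2 : ℂ)) * this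
  have hconst := is_const_of_deriv_eq_zero (fun y => (hGderiv y).differentiableAt)
    (fun y => (hGderiv y).deriv) a 0
  simp only [hF] at hconst
  rw [hconst]
  simp

lemma integral_exp_neg_mul_sin {z : ℂ} (hz : 0 < z.re) (k : ℝ) :
    ∫ τ in Set.Ioi (0:ℝ), Complex.exp (-z * τ) * (Real.sin (k * τ) : ℂ) = k / (z ^ 2 + k ^ 2) := by
  have h1 : (-z + k * Complex.I).re < 0 := by simpa using hz
  have h2 : (-z - k * Complex.I).re < 0 := by simpa using hz
  have e : ∀ τ : ℝ, Complex.exp (-z * τ) * (Real.sin (k * τ) : ℂ)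
      = (Complex.exp ((-z - k * Complex.I) * τ) - Complex.exp ((-z + k * Complex.I) * τ))
        * (Complex.I / 2) := by
    intro τ
    rw [Complex.ofReal_sin, Complex.sin,
      show (-z - k * Complex.I) * τ = -z * τ + -((k * τ : ℝ) : ℂ) * Complex.I by push_cast; ring,
      show (-z + k * Complex.I) * τ = -z * τ + ((k * τ : ℝ) : ℂ) * Complex.I by push_cast; ring,
      Complex.exp_add, Complex.exp_add]
    ring
  simp_rw [e]
  rw [integral_mul_const, integral_sub (integrableOn_exp_mul_complex_Ioi h2 0)
    (integrableOn_exp_mul_complex_Ioi h1 0), integral_exp_mul_complex_Ioi h1,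
    integral_exp_mul_complex_Ioi h2]
  have n1 : -z + k * Complex.I ≠ 0 := fun h => by simp [h] at h1
  have n2 : -z - k * Complex.I ≠ 0 := fun h => by simp [h] at h2
  have hfac : z ^ 2 + (k : ℂ) ^ 2 = (-z + k * Complex.I) * (-z - k * Complex.I) := by
    linear_combination ((k : ℂ) ^ 2) * Complex.I_sq
  rw [hfac]
  simp only [Complex.ofReal_zero, mul_zero, Complex.exp_zero]
  field_simp
  linear_combination (-2 * (k : ℂ)) * Complex.I_sq

lemma integrable_exp_neg_mul {z : ℂ} (hz : 0 < z.re) :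
    IntegrableOn (fun τ : ℝ => Complex.exp (-z * τ)) (Set.Ioi 0) :=
  integrableOn_exp_mul_complex_Ioi (by simpa using hz) 0

lemma sq_cpow_half {z : ℂ} (hz : 0 < z.re) : (z ^ 2) ^ (1 / 2 : ℂ) = z := by
  have h := abs_lt.1 (Complex.abs_arg_lt_pi_div_two_iff.2 (Or.inl hz))
  rw [one_div]
  exact Complex.pow_cpow_ofNat_inv (n := 2) (by simpa [neg_div] using h.1) (by simpa using h.2.le)

lemma sq_mem_slitPlane {z : ℂ} (hz : 0 < z.re) : z ^ 2 ∈ Complex.slitPlane := by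
  rw [Complex.mem_slitPlane_iff]
  by_cases him : z.im = 0
  · left
    simp only [pow_two, Complex.mul_re, him, mul_zero, sub_zero]
    positivity
  · right
    simp only [pow_two, Complex.mul_im]
    intro h
    rcases mul_eq_zero.1 (by linarith : z.re * z.im = 0) with h | h
    · exact hz.ne' h
    · exact him h

lemma laplace_besselJ_one {z : ℂ} (hz : 0 < z.re) {a : ℝ} (ha : 0 < a) :
    ∫ τ in Set.Ioi (0:ℝ), Complex.exp (-z * τ) * (besselJ 1 (a * τ) : ℂ)
      = (a : ℂ)⁻¹ * (1 - z / (z ^ 2 + (a ^ 2 : ℝ)) ^ (1 / 2 : ℂ)) := by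
  have hw := sq_mem_slitPlane hz
  have hpi : (Real.pi : ℂ) ≠ 0 := by exact_mod_cast Real.pi_pos.ne'
  have haC : (a : ℂ) ≠ 0 := by exact_mod_cast ha.ne'
  have hz0 : z ≠ 0 := fun h => by simp [h] at hz
  have hD : ∀ θ : ℝ, z ^ 2 + (a ^ 2 * Real.cos θ ^ 2 : ℝ) ≠ 0 := fun θ =>
    Complex.slitPlane_ne_zero (add_ofReal_mem_slitPlane hw (by positivity))
  have hint : Integrable (Function.uncurry fun (θ τ : ℝ) =>
      Complex.exp (-z * τ) * ((Real.sin (a * τ * Real.cos θ) * Real.cos θ : ℝ) : ℂ))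
      ((volume.restrict (Set.uIoc 0 Real.pi)).prod (volume.restrict (Set.Ioi 0))) := by
    have h1 : Integrable (fun _ : ℝ => (1 : ℂ)) (volume.restrict (Set.uIoc 0 Real.pi)) := by
      simp [Set.uIoc]
    have h := (h1.mul_prod (integrable_exp_neg_mul hz))
    refine h.mono (Continuous.aestronglyMeasurable (by unfold Function.uncurry; fun_prop))
      (Eventually.of_forall fun x => ?_)
    simp only [Function.uncurry, norm_mul, one_mul, Complex.norm_real]
    refine mul_le_of_le_one_right (norm_nonneg _) ?_
    exact mul_le_one₀ (Real.abs_sin_le_one _) (norm_nonneg _) (Real.abs_cos_le_one _)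
  have hswap := intervalIntegral_integral_swap hint
  have e1 : ∀ τ : ℝ, Complex.exp (-z * τ) * (besselJ 1 (a * τ) : ℂ)
      = (Real.pi : ℂ)⁻¹ * ∫ θ in (0:ℝ)..Real.pi,
        Complex.exp (-z * τ) * ((Real.sin (a * τ * Real.cos θ) * Real.cos θ : ℝ) : ℂ) := by
    intro τ
    rw [intervalIntegral.integral_const_mul, besselJ_one_eq, intervalIntegral.integral_ofReal]
    push_cast
    ring
  have e2 : ∀ θ : ℝ, ∫ τ in Set.Ioi (0:ℝ),
      Complex.exp (-z * τ) * ((Real.sin (a * τ * Real.cos θ) * Real.cos θ : ℝ) : ℂ)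
      = (a : ℂ)⁻¹ * (1 - z ^ 2 * (z ^ 2 + (a ^ 2 * Real.cos θ ^ 2 : ℝ))⁻¹) := by
    intro θ
    have : ∀ τ : ℝ, Complex.exp (-z * τ) * ((Real.sin (a * τ * Real.cos θ) * Real.cos θ : ℝ) : ℂ)
        = Complex.exp (-z * τ) * (Real.sin ((a * Real.cos θ) * τ) : ℂ) * (Real.cos θ : ℂ) := by
      intro τ
      rw [show a * τ * Real.cos θ = (a * Real.cos θ) * τ by ring]
      push_cast
      ring
    simp_rw [this]
    rw [integral_mul_const, integral_exp_neg_mul_sin hz]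
    have h0 := hD θ
    push_cast at h0 ⊢
    rw [mul_pow]
    field_simp
    ring
  simp_rw [e1]
  rw [integral_const_mul, ← hswap]
  simp_rw [e2]
  have hI : IntervalIntegrable (fun θ : ℝ => z ^ 2 * (z ^ 2 + (a ^ 2 * Real.cos θ ^ 2 : ℝ))⁻¹)
      volume 0 Real.pi :=
    (continuous_const.mul (Continuous.inv₀ (by fun_prop) hD)).intervalIntegrable _ _
  have hmain := integral_inv_add_sq_mul_cos_sq hw a
  rw [sq_cpow_half hz] at hmain
  rw [intervalIntegral.integral_const_mul, intervalIntegral.integral_sub intervalIntegrable_const hI,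
    intervalIntegral.integral_const_mul, intervalIntegral.integral_const]
  have hr : (z ^ 2 + (a ^ 2 : ℝ)) ^ (1 / 2 : ℂ) ≠ 0 := by
    rw [Ne, Complex.cpow_eq_zero_iff]
    exact fun h => Complex.slitPlane_ne_zero (add_ofReal_mem_slitPlane hw (sq_nonneg a)) h.1
  rw [← eq_div_iff hr] at hmain
  rw [hmain]
  simp only [sub_zero, Complex.real_smul, mul_one]
  field_simp

lemma abs_integral_sin_mul_cos_le {x : ℝ} (hx : 1 ≤ x) :
    |∫ θ in (0:ℝ)..Real.pi, Real.sin (x * Real.cos θ) * Real.cos θ| ≤ 10 / Real.sqrt x := by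
  have hx0 : 0 < x := one_pos.trans_le hx
  set δ := 1 / Real.sqrt x with hδ
  have hsx : 1 ≤ Real.sqrt x := Real.one_le_sqrt.2 hx
  have hδ0 : 0 < δ := by positivity
  have hδ1 : δ ≤ 1 := by rw [hδ, div_le_one (by positivity)]; exact hsx
  have hpi := Real.pi_gt_three
  have hδx : x⁻¹ = δ * δ := by
    rw [hδ, div_mul_div_comm, Real.mul_self_sqrt hx0.le, one_mul, one_div]
  have hint : ∀ s t : ℝ, IntervalIntegrable (fun θ => Real.sin (x * Real.cos θ) * Real.cos θ)
      volume s t := fun s t => by apply Continuous.intervalIntegrable; fun_prop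
  have hsmall : ∀ s t : ℝ, s ≤ t →
      |∫ θ in s..t, Real.sin (x * Real.cos θ) * Real.cos θ| ≤ t - s := by
    intro s t hst
    have h := intervalIntegral.norm_integral_le_of_norm_le_const (a := s) (b := t) (C := 1)
      (f := fun θ => Real.sin (x * Real.cos θ) * Real.cos θ) (fun θ _ => by
        rw [norm_mul]
        exact mul_le_one₀ (Real.abs_sin_le_one _) (norm_nonneg _) (Real.abs_cos_le_one _))
    rwa [abs_of_nonneg (sub_nonneg.2 hst), one_mul, Real.norm_eq_abs] at h
  have hle : δ ≤ Real.pi - δ := by linarith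
  have hsin : ∀ θ ∈ Set.uIcc δ (Real.pi - δ), 0 < Real.sin θ := by
    intro θ hθ
    rw [Set.uIcc_of_le hle] at hθ
    exact Real.sin_pos_of_pos_of_lt_pi (hδ0.trans_le hθ.1) (by linarith [hθ.2])
  have hcot : ∀ θ ∈ Set.uIcc δ (Real.pi - δ),
      HasDerivAt (fun θ => Real.cos θ / Real.sin θ) (-(Real.sin θ ^ 2)⁻¹) θ := by
    intro θ hθ
    have h0 := (hsin θ hθ).ne'
    refine ((Real.hasDerivAt_cos θ).fun_div (Real.hasDerivAt_sin θ) h0).congr_deriv ?_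
    field_simp
    linear_combination -Real.sin_sq_add_cos_sq θ
  have hinv : ContinuousOn (fun θ => -(Real.sin θ ^ 2)⁻¹) (Set.uIcc δ (Real.pi - δ)) :=
    (ContinuousOn.inv₀ (by fun_prop) fun θ hθ => pow_ne_zero 2 (hsin θ hθ).ne').neg
  have hparts := intervalIntegral.integral_mul_deriv_eq_deriv_mul (a := δ) (b := Real.pi - δ)
    (v := fun θ => x⁻¹ * Real.cos (x * Real.cos θ))
    (v' := fun θ => Real.sin (x * Real.cos θ) * Real.sin θ) hcot
    (fun θ _ => (((Real.hasDerivAt_cos θ).const_mul x).cos.const_mul x⁻¹).congr_deriv (by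
      field_simp))
    hinv.intervalIntegrable (by apply Continuous.intervalIntegrable; fun_prop)
  have hmid : ∫ θ in δ..(Real.pi - δ), Real.sin (x * Real.cos θ) * Real.cos θ
      = ∫ θ in δ..(Real.pi - δ),
        Real.cos θ / Real.sin θ * (Real.sin (x * Real.cos θ) * Real.sin θ) := by
    refine intervalIntegral.integral_congr fun θ hθ => ?_
    have h0 := (hsin θ hθ).ne'
    field_simp
  have hcotδ : Real.cos δ / Real.sin δ ≤ 2 / δ := by
    have h1 : 2 / Real.pi * δ ≤ Real.sin δ := Real.mul_le_sin hδ0.le (by linarith)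
    have h2 : δ / 2 ≤ Real.sin δ := by
      refine le_trans ?_ h1
      rw [div_mul_eq_mul_div, div_le_div_iff₀ two_pos Real.pi_pos]
      nlinarith [Real.pi_le_four]
    calc Real.cos δ / Real.sin δ ≤ 1 / (δ / 2) := by
          gcongr
          exact Real.cos_le_one δ
      _ = 2 / δ := by field_simp
  have hcotδ0 : 0 ≤ Real.cos δ / Real.sin δ :=
    div_nonneg (Real.cos_nonneg_of_neg_pi_div_two_le_of_le (by linarith) (by linarith))
      (hsin δ Set.left_mem_uIcc).le
  have hrem : |∫ θ in δ..(Real.pi - δ), -(Real.sin θ ^ 2)⁻¹ * (x⁻¹ * Real.cos (x * Real.cos θ))|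
      ≤ x⁻¹ * (2 * (Real.cos δ / Real.sin δ)) := by
    have hcotint := intervalIntegral.integral_eq_sub_of_hasDerivAt hcot hinv.intervalIntegrable
    have hb := intervalIntegral.norm_integral_le_of_norm_le (μ := volume)
      (f := fun θ => -(Real.sin θ ^ 2)⁻¹ * (x⁻¹ * Real.cos (x * Real.cos θ)))
      (g := fun θ => -x⁻¹ * -(Real.sin θ ^ 2)⁻¹) hle (Eventually.of_forall fun θ _ => by
        rw [norm_mul, norm_neg, norm_mul, Real.norm_of_nonneg (by positivity : 0 ≤ x⁻¹),
          Real.norm_of_nonneg (by positivity : 0 ≤ (Real.sin θ ^ 2)⁻¹)]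
        have : ‖Real.cos (x * Real.cos θ)‖ ≤ 1 := Real.abs_cos_le_one _
        have h2 : 0 ≤ (Real.sin θ ^ 2)⁻¹ * x⁻¹ := by positivity
        nlinarith) (hinv.intervalIntegrable.const_mul _)
    rw [intervalIntegral.integral_const_mul, hcotint, Real.cos_pi_sub, Real.sin_pi_sub] at hb
    refine hb.trans_eq ?_
    ring
  have hmidle : |∫ θ in δ..(Real.pi - δ), Real.sin (x * Real.cos θ) * Real.cos θ| ≤ 8 * δ := by
    rw [hmid, hparts, Real.cos_pi_sub, Real.sin_pi_sub]
    have hx1 : 0 < x⁻¹ := by positivity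
    have hB : ∀ y, |x⁻¹ * Real.cos y| ≤ x⁻¹ := fun y => by
      rw [abs_mul, abs_of_pos hx1]
      exact mul_le_of_le_one_right hx1.le (Real.abs_cos_le_one y)
    have h1 : |-Real.cos δ / Real.sin δ * (x⁻¹ * Real.cos (x * -Real.cos δ))|
        ≤ Real.cos δ / Real.sin δ * x⁻¹ := by
      rw [neg_div, abs_mul, abs_neg, abs_of_nonneg hcotδ0]
      exact mul_le_mul_of_nonneg_left (hB _) hcotδ0
    have h2 : |Real.cos δ / Real.sin δ * (x⁻¹ * Real.cos (x * Real.cos δ))|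
        ≤ Real.cos δ / Real.sin δ * x⁻¹ := by
      rw [abs_mul, abs_of_nonneg hcotδ0]
      exact mul_le_mul_of_nonneg_left (hB _) hcotδ0
    have h3 : Real.cos δ / Real.sin δ * x⁻¹ ≤ 2 * δ := by
      calc Real.cos δ / Real.sin δ * x⁻¹ ≤ 2 / δ * x⁻¹ := by gcongr
        _ = 2 * δ := by rw [hδx]; field_simp
    refine (abs_sub _ _).trans ?_
    have := abs_sub (-Real.cos δ / Real.sin δ * (x⁻¹ * Real.cos (x * -Real.cos δ)))
      (Real.cos δ / Real.sin δ * (x⁻¹ * Real.cos (x * Real.cos δ)))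
    linarith
  rw [← intervalIntegral.integral_add_adjacent_intervals (hint 0 δ) (hint δ Real.pi),
    ← intervalIntegral.integral_add_adjacent_intervals (hint δ (Real.pi - δ)) (hint _ Real.pi)]
  have h1 := hsmall 0 δ hδ0.le
  have h2 := hsmall (Real.pi - δ) Real.pi (by linarith)
  have h3 : 10 / Real.sqrt x = 10 * δ := by rw [hδ]; ring
  rw [h3]
  refine (abs_add_le _ _).trans ?_
  have := abs_add_le (∫ θ in δ..(Real.pi - δ), Real.sin (x * Real.cos θ) * Real.cos θ)
    (∫ θ in (Real.pi - δ)..Real.pi, Real.sin (x * Real.cos θ) * Real.cos θ)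
  linarith

lemma abs_besselJ_one_le {x : ℝ} (hx : 0 < x) : |besselJ 1 x| ≤ 10 / Real.sqrt x := by
  have hs : 0 < Real.sqrt x := Real.sqrt_pos.2 hx
  rcases le_total 1 x with h | h
  · rw [besselJ_one_eq, abs_mul, abs_of_pos (inv_pos.2 Real.pi_pos)]
    refine (mul_le_of_le_one_left (abs_nonneg _) ?_).trans (abs_integral_sin_mul_cos_le h)
    exact inv_le_one_of_one_le₀ (by linarith [Real.pi_gt_three])
  · refine (abs_besselJ_one_le_one x).trans ?_
    rw [le_div_iff₀ hs]
    linarith [Real.sqrt_le_one.2 h]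

lemma integrableOn_div_mul_besselJ_one {a p : ℝ} (ha : 0 < a) (hp : 0 < p) :
    IntegrableOn (fun τ => τ / (τ ^ 2 + p ^ 2) * besselJ 1 (a * τ)) (Set.Ioi 0) := by
  have hcont : Continuous fun τ => τ / (τ ^ 2 + p ^ 2) * besselJ 1 (a * τ) :=
    (Continuous.div (by fun_prop) (by fun_prop) fun τ => by positivity).mul
      (continuous_besselJ_one.comp (by fun_prop))
  rw [← Set.Ioc_union_Ioi_eq_Ioi (zero_le_one (α := ℝ))]
  refine IntegrableOn.union
    ((hcont.integrableOn_Icc (a := 0) (b := 1)).mono_set Set.Ioc_subset_Icc_self) ?_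
  have hr : IntegrableOn (fun τ : ℝ => 10 / Real.sqrt a * τ ^ (-(3 / 2) : ℝ)) (Set.Ioi 1) :=
    (integrableOn_Ioi_rpow_of_lt (by norm_num) one_pos).const_mul _
  refine Integrable.mono' hr hcont.aestronglyMeasurable
    ((ae_restrict_iff' measurableSet_Ioi).2 (Eventually.of_forall fun τ hτ => ?_))
  have hτ0 : 0 < τ := one_pos.trans hτ
  have hsτ := Real.sqrt_pos.2 hτ0
  have hsa := Real.sqrt_pos.2 ha
  have hpow : τ ^ (-(3 / 2) : ℝ) = τ⁻¹ * (Real.sqrt τ)⁻¹ := by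
    rw [show (-(3 / 2) : ℝ) = -1 + -(1 / 2) by norm_num, Real.rpow_add hτ0, Real.rpow_neg_one,
      Real.rpow_neg hτ0.le, Real.sqrt_eq_rpow]
  have h1 : ‖τ / (τ ^ 2 + p ^ 2)‖ ≤ τ⁻¹ := by
    rw [Real.norm_of_nonneg (by positivity), div_le_iff₀ (by positivity)]
    field_simp
    nlinarith
  have h2 := abs_besselJ_one_le (mul_pos ha hτ0)
  rw [Real.sqrt_mul ha.le] at h2
  rw [norm_mul, hpow]
  calc _ ≤ τ⁻¹ * (10 / (Real.sqrt a * Real.sqrt τ)) :=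
        mul_le_mul h1 h2 (abs_nonneg _) (by positivity)
    _ = _ := by field_simp

/-- The kernel whose cosine transform on the half-line is `τ * sin (c * τ) / (τ ^ 2 + p ^ 2)`. -/
noncomputable def cosKernel (p c u : ℝ) : ℝ :=
  if u ≤ c then Real.exp (-(p * c)) * Real.cosh (p * u)
  else -(Real.exp (-(p * u)) * Real.sinh (p * c))

lemma measurable_cosKernel (p c : ℝ) : Measurable (cosKernel p c) :=
  Measurable.ite measurableSet_Iic (by fun_prop) (by fun_prop)

lemma abs_cosKernel_le {p c u : ℝ} (hp : 0 < p) (hc : 0 ≤ c) (hu : 0 ≤ u) :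
    |cosKernel p c u| ≤ Real.exp (p * c) * Real.exp (-(p * u)) := by
  rw [cosKernel]
  have hpc : 0 ≤ p * c := by positivity
  have hpu : 0 ≤ p * u := by positivity
  split_ifs with h
  · rw [abs_of_nonneg (by positivity)]
    have h1 : Real.cosh (p * u) ≤ Real.exp (p * u) := by
      rw [Real.cosh_eq]
      linarith [Real.exp_le_exp.2 (by linarith : -(p * u) ≤ p * u)]
    calc _ ≤ Real.exp (-(p * c)) * Real.exp (p * u) := by gcongr
      _ ≤ _ := by
        rw [← Real.exp_add, ← Real.exp_add, Real.exp_le_exp]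
        nlinarith
  · have h1 : Real.sinh (p * c) ≤ Real.exp (p * c) := by
      rw [Real.sinh_eq]
      linarith [Real.exp_pos (p * c), Real.exp_pos (-(p * c))]
    have h2 : 0 ≤ Real.sinh (p * c) := Real.sinh_nonneg_iff.2 hpc
    rw [abs_neg, abs_of_nonneg (by positivity), mul_comm]
    gcongr

lemma integrableOn_exp_neg_mul {p : ℝ} (hp : 0 < p) (c : ℝ) :
    IntegrableOn (fun u : ℝ => Real.exp (-(p * u))) (Set.Ioi c) := by
  simpa only [neg_mul] using exp_neg_integrableOn_Ioi c hp

lemma integrableOn_cosKernel {p c : ℝ} (hp : 0 < p) (hc : 0 ≤ c) :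
    IntegrableOn (cosKernel p c) (Set.Ioi 0) :=
  ((integrableOn_exp_neg_mul hp 0).const_mul (Real.exp (p * c))).mono'
    (measurable_cosKernel p c).aestronglyMeasurable
    ((ae_restrict_iff' measurableSet_Ioi).2 (Eventually.of_forall fun _ hu =>
      abs_cosKernel_le hp hc (le_of_lt hu)))

lemma integral_cosKernel_mul_cos {p c : ℝ} (hp : 0 < p) (hc : 0 ≤ c) (τ : ℝ) :
    ∫ u in Set.Ioi (0:ℝ), cosKernel p c u * Real.cos (u * τ)
      = τ * Real.sin (c * τ) / (τ ^ 2 + p ^ 2) := by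
  have hd : τ ^ 2 + p ^ 2 ≠ 0 := by positivity
  have hint : IntegrableOn (fun u => cosKernel p c u * Real.cos (u * τ)) (Set.Ioi 0) :=
    (integrableOn_cosKernel hp hc).mul_bdd (c := 1)
      (Continuous.aestronglyMeasurable (by fun_prop))
      (Eventually.of_forall fun u => Real.abs_cos_le_one _)
  rw [← Set.Ioc_union_Ioi_eq_Ioi hc, setIntegral_union (Set.Ioc_disjoint_Ioi le_rfl)
    measurableSet_Ioi (hint.mono_set Set.Ioc_subset_Ioi_self)
    (hint.mono_set (Set.Ioi_subset_Ioi hc))]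
  have hcos : ∀ u : ℝ, HasDerivAt (fun u => Real.cos (u * τ)) (-Real.sin (u * τ) * τ) u :=
    fun u => (((hasDerivAt_id u).mul_const τ).cos).congr_deriv (by simp)
  have hsin : ∀ u : ℝ, HasDerivAt (fun u => Real.sin (u * τ)) (Real.cos (u * τ) * τ) u :=
    fun u => (((hasDerivAt_id u).mul_const τ).sin).congr_deriv (by simp)
  have h1 : ∫ u in Set.Ioc 0 c, cosKernel p c u * Real.cos (u * τ)
      = Real.exp (-(p * c)) * ((p * Real.sinh (p * c) * Real.cos (c * τ)
        + τ * Real.cosh (p * c) * Real.sin (c * τ)) / (τ ^ 2 + p ^ 2)) := by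
    have e : ∫ u in Set.Ioc 0 c, cosKernel p c u * Real.cos (u * τ)
        = ∫ u in (0:ℝ)..c, Real.exp (-(p * c)) * (Real.cosh (p * u) * Real.cos (u * τ)) := by
      rw [intervalIntegral.integral_of_le hc]
      refine setIntegral_congr_fun measurableSet_Ioc fun u hu => ?_
      simp only [cosKernel, if_pos hu.2]
      ring
    have hder : ∀ u ∈ Set.uIcc 0 c, HasDerivAt
        (fun u => (p * (Real.sinh (p * u) * Real.cos (u * τ))
          + τ * (Real.cosh (p * u) * Real.sin (u * τ))) / (τ ^ 2 + p ^ 2))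
        (Real.cosh (p * u) * Real.cos (u * τ)) u := by
      intro u _
      have hpu := (hasDerivAt_id u).const_mul p
      refine (((((hpu.sinh).fun_mul (hcos u)).const_mul p).fun_add
        (((hpu.cosh).fun_mul (hsin u)).const_mul τ)).div_const _).congr_deriv ?_
      simp only [id]
      field_simp
      ring
    rw [e, intervalIntegral.integral_const_mul, intervalIntegral.integral_eq_sub_of_hasDerivAt hder
      (by apply Continuous.intervalIntegrable; fun_prop)]
    simp
    ring
  have h2 : ∫ u in Set.Ioi c, cosKernel p c u * Real.cos (u * τ)
      = -(Real.sinh (p * c) * (Real.exp (-(p * c)) *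
        ((p * Real.cos (c * τ) - τ * Real.sin (c * τ)) / (τ ^ 2 + p ^ 2)))) := by
    have e : ∫ u in Set.Ioi c, cosKernel p c u * Real.cos (u * τ)
        = ∫ u in Set.Ioi c, -Real.sinh (p * c) * (Real.exp (-(p * u)) * Real.cos (u * τ)) := by
      refine setIntegral_congr_fun measurableSet_Ioi fun u hu => ?_
      simp only [cosKernel, if_neg (not_le.2 (Set.mem_Ioi.1 hu))]
      ring
    have hder : ∀ u ∈ Set.Ici c, HasDerivAt
        (fun u => Real.exp (-(p * u)) * ((τ * Real.sin (u * τ)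
          - p * Real.cos (u * τ)) / (τ ^ 2 + p ^ 2)))
        (Real.exp (-(p * u)) * Real.cos (u * τ)) u := by
      intro u _
      have hpu := ((hasDerivAt_id u).const_mul p).fun_neg
      refine ((hpu.exp).fun_mul ((((hsin u).const_mul τ).fun_sub
        ((hcos u).const_mul p)).div_const _)).congr_deriv ?_
      simp only [id]
      field_simp
      ring
    have hlim : Tendsto (fun u => Real.exp (-(p * u)) * ((τ * Real.sin (u * τ)
          - p * Real.cos (u * τ)) / (τ ^ 2 + p ^ 2))) atTop (nhds 0) := by
      have hexp : Tendsto (fun u => Real.exp (-(p * u))) atTop (nhds 0) :=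
        Real.tendsto_exp_neg_atTop_nhds_zero.comp (tendsto_id.const_mul_atTop hp)
      refine hexp.zero_mul_isBoundedUnder_le
        (isBoundedUnder_of ⟨(|τ| + p) / (τ ^ 2 + p ^ 2), fun u => ?_⟩)
      simp only [Function.comp_apply, Real.norm_eq_abs]
      rw [abs_div, abs_of_pos (by positivity : 0 < τ ^ 2 + p ^ 2)]
      gcongr
      refine (abs_sub _ _).trans ?_
      rw [abs_mul, abs_mul, abs_of_pos hp]
      gcongr
      · exact mul_le_of_le_one_right (abs_nonneg _) (Real.abs_sin_le_one _)
      · exact mul_le_of_le_one_right hp.le (Real.abs_cos_le_one _)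
    have hi : IntegrableOn (fun u => Real.exp (-(p * u)) * Real.cos (u * τ)) (Set.Ioi c) :=
      (integrableOn_exp_neg_mul hp c).mul_bdd (c := 1)
        (Continuous.aestronglyMeasurable (by fun_prop))
        (Eventually.of_forall fun u => Real.abs_cos_le_one _)
    rw [e, integral_const_mul, integral_Ioi_of_hasDerivAt_of_tendsto' hder hi hlim]
    ring
  rw [h1, h2]
  have h3 : Real.exp (-(p * c)) * (Real.cosh (p * c) + Real.sinh (p * c)) = 1 := by
    rw [Real.cosh_add_sinh, ← Real.exp_add, neg_add_cancel, Real.exp_zero]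
  field_simp
  linear_combination (τ * Real.sin (c * τ)) * h3

lemma cpow_half_eq_of_im_neg {w : ℂ} (hw : w.im < 0) :
    w ^ (1 / 2 : ℂ) = -Complex.I * (-w) ^ (1 / 2 : ℂ) := by
  have h0 : w ≠ 0 := fun h => by simp [h] at hw
  have hlog : Complex.log (-w) = Complex.log w + Real.pi * Complex.I := by
    rw [Complex.log, Complex.log, norm_neg, Complex.arg_neg_eq_arg_add_pi_of_im_neg hw]
    push_cast
    ring
  rw [Complex.cpow_def_of_ne_zero h0, Complex.cpow_def_of_ne_zero (neg_ne_zero.2 h0), hlog,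
    add_mul, Complex.exp_add, show Real.pi * Complex.I * (1 / 2) = Real.pi / 2 * Complex.I by ring,
    Complex.exp_pi_div_two_mul_I]
  linear_combination Complex.exp (Complex.log w * (1 / 2)) * Complex.I_sq

/-- The non-constant part of the cosine-Laplace transform of `besselJ 1 (a * ·)`. -/
noncomputable def laplaceQuotient (a s u : ℝ) : ℝ :=
  ((s - u * Complex.I) / ((s - u * Complex.I) ^ 2 + (a ^ 2 : ℝ)) ^ (1 / 2 : ℂ)).re

lemma measurable_laplaceQuotient (a s : ℝ) : Measurable (laplaceQuotient a s) := by
  unfold laplaceQuotient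
  fun_prop

lemma mul_abs_sub_le_norm {a s u : ℝ} (ha : 0 < a) (hu : 0 ≤ u) :
    a * |u - a| ≤ ‖((s - u * Complex.I) ^ 2 + (a ^ 2 : ℝ) : ℂ)‖ := by
  have hfac : ((s - u * Complex.I) ^ 2 + (a ^ 2 : ℝ) : ℂ)
      = ((a + u : ℝ) + s * Complex.I) * ((a - u : ℝ) - s * Complex.I) := by
    push_cast
    linear_combination (((u : ℂ)) ^ 2 + s ^ 2) * Complex.I_sq
  rw [hfac, norm_mul]
  have h1 := Complex.abs_re_le_norm ((a + u : ℝ) + s * Complex.I)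
  have h2 := Complex.abs_re_le_norm ((a - u : ℝ) - s * Complex.I)
  simp only [Complex.add_re, Complex.sub_re, Complex.ofReal_re, Complex.mul_re, Complex.I_re,
    Complex.I_im, Complex.ofReal_im, mul_zero, zero_mul, sub_zero, add_zero] at h1 h2
  rw [abs_sub_comm]
  refine mul_le_mul (le_trans ?_ h1) h2 (abs_nonneg _) (norm_nonneg _)
  rw [abs_of_nonneg (by linarith)]
  linarith

lemma abs_laplaceQuotient_le {a s u : ℝ} (ha : 0 < a) (hs : 0 ≤ s) (hs1 : s ≤ 1) (hu : 0 ≤ u)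
    (hua : u ≠ a) :
    |laplaceQuotient a s u| ≤ (1 + u) * (a ^ (-(1 / 2) : ℝ) * |u - a| ^ (-(1 / 2) : ℝ)) := by
  refine (Complex.abs_re_le_norm _).trans ?_
  have hpos : 0 < a * |u - a| := mul_pos ha (abs_pos.2 (sub_ne_zero.2 hua))
  have hle := mul_abs_sub_le_norm (s := s) ha hu
  have hhalf : (1 / 2 : ℂ) = ((1 / 2 : ℝ) : ℂ) := by norm_num
  rw [norm_div, hhalf, Complex.norm_cpow_real, div_eq_mul_inv, ← Real.rpow_neg (norm_nonneg _),
    ← Real.mul_rpow ha.le (abs_nonneg _)]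
  refine mul_le_mul ?_ (Real.rpow_le_rpow_of_nonpos hpos hle (by norm_num)) (by positivity)
    (by positivity)
  refine (norm_sub_le _ _).trans ?_
  simp only [norm_mul, Complex.norm_real, Complex.norm_I, mul_one, Real.norm_eq_abs,
    abs_of_nonneg hs, abs_of_nonneg hu]
  linarith

lemma tendsto_laplaceQuotient {a u : ℝ} (ha : 0 < a) (hu : 0 < u) (hua : u ≠ a) :
    Tendsto (fun s => laplaceQuotient a s u) (nhdsWithin 0 (Set.Ioi 0))
      (nhds ((Set.Ioi a).indicator (fun u => u / Real.sqrt (u ^ 2 - a ^ 2)) u)) := by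
  have hhalf : (1 / 2 : ℂ) = ((1 / 2 : ℝ) : ℂ) := by norm_num
  have hreal : ∀ y : ℝ, 0 ≤ y → ((y : ℝ) : ℂ) ^ (1 / 2 : ℂ) = (Real.sqrt y : ℂ) := fun y hy => by
    rw [hhalf, ← Complex.ofReal_cpow hy, ← Real.sqrt_eq_rpow]
  have hz : Tendsto (fun s : ℝ => (s - u * Complex.I : ℂ)) (nhdsWithin 0 (Set.Ioi 0))
      (nhds (-(u * Complex.I))) := by
    have : Continuous fun s : ℝ => (s - u * Complex.I : ℂ) := by fun_prop
    have h := (this.tendsto 0).mono_left (nhdsWithin_le_nhds (s := Set.Ioi 0))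
    simpa using h
  have hw : Tendsto (fun s : ℝ => ((s - u * Complex.I) ^ 2 + (a ^ 2 : ℝ) : ℂ))
      (nhdsWithin 0 (Set.Ioi 0)) (nhds ((a ^ 2 - u ^ 2 : ℝ) : ℂ)) := by
    have h := (hz.pow 2).add_const ((a ^ 2 : ℝ) : ℂ)
    convert h using 2
    push_cast
    linear_combination -(u : ℂ) ^ 2 * Complex.I_sq
  rcases lt_or_gt_of_ne hua with h | h
  · rw [Set.indicator_of_notMem (by simpa using h.le)]
    have hpos : 0 < a ^ 2 - u ^ 2 := by nlinarith
    have hmem : ((a ^ 2 - u ^ 2 : ℝ) : ℂ) ∈ Complex.slitPlane :=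
      Complex.ofReal_mem_slitPlane.2 hpos
    have hc := ((continuousAt_cpow_const (b := (1 / 2 : ℂ)) hmem).tendsto.comp hw)
    have hq := hz.div hc (by
      rw [hreal _ hpos.le]
      exact_mod_cast (Real.sqrt_pos.2 hpos).ne')
    have := (Complex.continuous_re.tendsto _).comp hq
    rw [hreal _ hpos.le] at this
    simpa [laplaceQuotient, Function.comp_def, Complex.div_ofReal_re] using this
  · rw [Set.indicator_of_mem (by exact h)]
    have hpos : 0 < u ^ 2 - a ^ 2 := by nlinarith
    have hmem : ((u ^ 2 - a ^ 2 : ℝ) : ℂ) ∈ Complex.slitPlane :=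
      Complex.ofReal_mem_slitPlane.2 hpos
    have hwneg : Tendsto (fun s : ℝ => -((s - u * Complex.I) ^ 2 + (a ^ 2 : ℝ) : ℂ))
        (nhdsWithin 0 (Set.Ioi 0)) (nhds ((u ^ 2 - a ^ 2 : ℝ) : ℂ)) := by
      convert hw.neg using 2
      push_cast
      ring
    have hc := ((continuousAt_cpow_const (b := (1 / 2 : ℂ)) hmem).tendsto.comp hwneg).const_mul
      (-Complex.I)
    have hsq : (Real.sqrt (u ^ 2 - a ^ 2) : ℂ) ≠ 0 := by
      exact_mod_cast (Real.sqrt_pos.2 hpos).ne'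
    rw [hreal _ hpos.le] at hc
    have hq := hz.div hc (mul_ne_zero (neg_ne_zero.2 Complex.I_ne_zero) hsq)
    have hval : -(u * Complex.I) / (-Complex.I * (Real.sqrt (u ^ 2 - a ^ 2) : ℂ))
        = ((u / Real.sqrt (u ^ 2 - a ^ 2) : ℝ) : ℂ) := by
      push_cast
      have := Complex.I_ne_zero
      field_simp
    rw [hval] at hq
    have hre := (Complex.continuous_re.tendsto _).comp hq
    rw [Complex.ofReal_re] at hre
    refine hre.congr' ?_
    filter_upwards [self_mem_nhdsWithin] with s hs
    have him : ((s - u * Complex.I) ^ 2 + (a ^ 2 : ℝ) : ℂ).im < 0 := by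
      have : ((s - u * Complex.I) ^ 2 + (a ^ 2 : ℝ) : ℂ).im = -(2 * (s * u)) := by
        simp [pow_two]
        ring
      rw [this]
      have : 0 < s * u := mul_pos hs hu
      linarith
    simp only [laplaceQuotient, Function.comp_apply, Pi.div_apply]
    rw [cpow_half_eq_of_im_neg him]

lemma integrableOn_exp_neg_mul_abs_sub_rpow {a q : ℝ} (ha : 0 < a) (hq : 0 < q) :
    IntegrableOn (fun u => Real.exp (-(q * u)) * |u - a| ^ (-(1 / 2) : ℝ)) (Set.Ioi 0) := by
  have hmeas : Measurable fun u => Real.exp (-(q * u)) * |u - a| ^ (-(1 / 2) : ℝ) := by fun_prop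
  have hpow : IntegrableOn (fun u => |u - a| ^ (-(1 / 2) : ℝ)) (Set.Ioc 0 (a + 1)) := by
    have hx : ∀ t, IntervalIntegrable (fun x : ℝ => x ^ (-(1 / 2) : ℝ)) volume 0 t := fun t =>
      intervalIntegral.intervalIntegrable_rpow' (by norm_num)
    have h1 : IntervalIntegrable (fun u => (a - u) ^ (-(1 / 2) : ℝ)) volume 0 a := by
      have := (hx a).comp_sub_left a
      simpa using this.symm
    have h2 : IntervalIntegrable (fun u => (u - a) ^ (-(1 / 2) : ℝ)) volume a (a + 1) := by
      have := (hx 1).comp_sub_right a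
      simpa [add_comm] using this
    rw [intervalIntegrable_iff_integrableOn_Ioc_of_le (by linarith)] at h1 h2
    rw [← Set.Ioc_union_Ioc_eq_Ioc ha.le (by linarith : a ≤ a + 1)]
    refine IntegrableOn.union (h1.congr_fun (fun u hu => ?_) measurableSet_Ioc)
      (h2.congr_fun (fun u hu => ?_) measurableSet_Ioc)
    · simp only
      rw [abs_sub_comm, abs_of_nonneg (by linarith [hu.2])]
    · simp only
      rw [abs_of_nonneg (by linarith [hu.1])]
  rw [← Set.Ioc_union_Ioi_eq_Ioi (by linarith : 0 ≤ a + 1)]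
  refine IntegrableOn.union ?_ ?_
  · refine Integrable.mono' hpow hmeas.aestronglyMeasurable
      ((ae_restrict_iff' measurableSet_Ioc).2 (Eventually.of_forall fun u hu => ?_))
    rw [Real.norm_of_nonneg (by positivity)]
    refine mul_le_of_le_one_left (by positivity) ?_
    rw [Real.exp_le_one_iff]
    nlinarith [hu.1]
  · refine Integrable.mono' (integrableOn_exp_neg_mul hq (a + 1)) hmeas.aestronglyMeasurable
      ((ae_restrict_iff' measurableSet_Ioi).2 (Eventually.of_forall fun u hu => ?_))
    rw [Real.norm_of_nonneg (by positivity)]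
    refine mul_le_of_le_one_right (by positivity) ?_
    have hu' : a + 1 < u := hu
    rw [abs_of_nonneg (by linarith)]
    exact Real.rpow_le_one_of_one_le_of_nonpos (by linarith) (by norm_num)

/-- A majorant of `cosKernel p c u * laplaceQuotient a s u`, uniform in `s ∈ [0, 1]`. -/
noncomputable def kernelMajorant (a p c u : ℝ) : ℝ :=
  Real.exp (p * c) * (1 + 2 / p) * a ^ (-(1 / 2) : ℝ) *
    (Real.exp (-(p / 2 * u)) * |u - a| ^ (-(1 / 2) : ℝ))

lemma integrableOn_kernelMajorant {a p : ℝ} (ha : 0 < a) (hp : 0 < p) (c : ℝ) :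
    IntegrableOn (kernelMajorant a p c) (Set.Ioi 0) :=
  (integrableOn_exp_neg_mul_abs_sub_rpow ha (half_pos hp)).const_mul _

lemma norm_cosKernel_mul_laplaceQuotient_le {a p c s u : ℝ} (ha : 0 < a) (hp : 0 < p)
    (hc : 0 ≤ c) (hs : 0 ≤ s) (hs1 : s ≤ 1) (hu : 0 ≤ u) (hua : u ≠ a) :
    ‖cosKernel p c u * laplaceQuotient a s u‖ ≤ kernelMajorant a p c u := by
  have h1 := abs_cosKernel_le hp hc hu
  have h2 := abs_laplaceQuotient_le ha hs hs1 hu hua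
  have h3 : Real.exp (-(p * u)) * (1 + u) ≤ (1 + 2 / p) * Real.exp (-(p / 2 * u)) := by
    have hsplit : Real.exp (-(p * u)) = Real.exp (-(p / 2 * u)) * Real.exp (-(p / 2 * u)) := by
      rw [← Real.exp_add]
      ring_nf
    have hle : 1 + u ≤ (1 + 2 / p) * Real.exp (p / 2 * u) := by
      have he := Real.add_one_le_exp (p / 2 * u)
      have hpu : 0 ≤ p * u := by positivity
      calc 1 + u ≤ (1 + 2 / p) * (p / 2 * u + 1) := by
            have : (1 + 2 / p) * (p / 2 * u + 1) = 1 + u + (p / 2 * u + 2 / p) := by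
              field_simp
              ring
            rw [this]
            have : 0 ≤ p / 2 * u + 2 / p := by positivity
            linarith
        _ ≤ _ := by gcongr
    rw [hsplit]
    calc _ ≤ Real.exp (-(p / 2 * u)) * Real.exp (-(p / 2 * u))
          * ((1 + 2 / p) * Real.exp (p / 2 * u)) := by gcongr
      _ = (1 + 2 / p) * Real.exp (-(p / 2 * u))
          * (Real.exp (-(p / 2 * u)) * Real.exp (p / 2 * u)) := by ring
      _ = _ := by rw [← Real.exp_add, neg_add_cancel, Real.exp_zero, mul_one]
  rw [norm_mul, kernelMajorant]
  calc _ ≤ (Real.exp (p * c) * Real.exp (-(p * u))) *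
        ((1 + u) * (a ^ (-(1 / 2) : ℝ) * |u - a| ^ (-(1 / 2) : ℝ))) :=
        mul_le_mul h1 h2 (abs_nonneg _) (by positivity)
    _ = Real.exp (p * c) * a ^ (-(1 / 2) : ℝ) * |u - a| ^ (-(1 / 2) : ℝ)
        * (Real.exp (-(p * u)) * (1 + u)) := by ring
    _ ≤ Real.exp (p * c) * a ^ (-(1 / 2) : ℝ) * |u - a| ^ (-(1 / 2) : ℝ)
        * ((1 + 2 / p) * Real.exp (-(p / 2 * u))) := by gcongr
    _ = _ := by ring

lemma ae_restrict_Ioi_pos_and_ne (a : ℝ) :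
    ∀ᵐ u : ℝ ∂volume.restrict (Set.Ioi 0), 0 < u ∧ u ≠ a :=
  (ae_restrict_mem measurableSet_Ioi).and (ae_restrict_of_ae (Measure.ae_ne volume a))

lemma integrableOn_cosKernel_mul_laplaceQuotient {a p c s : ℝ} (ha : 0 < a) (hp : 0 < p)
    (hc : 0 ≤ c) (hs : 0 ≤ s) (hs1 : s ≤ 1) :
    IntegrableOn (fun u => cosKernel p c u * laplaceQuotient a s u) (Set.Ioi 0) := by
  refine Integrable.mono' (integrableOn_kernelMajorant ha hp c)
    ((measurable_cosKernel p c).mul (measurable_laplaceQuotient a s)).aestronglyMeasurable ?_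
  filter_upwards [ae_restrict_Ioi_pos_and_ne a] with u hu
  exact norm_cosKernel_mul_laplaceQuotient_le ha hp hc hs hs1 hu.1.le hu.2

lemma tendsto_integral_cosKernel_mul_laplaceQuotient {a p c : ℝ} (ha : 0 < a) (hp : 0 < p)
    (hc : 0 ≤ c) :
    Tendsto (fun s => ∫ u in Set.Ioi (0:ℝ), cosKernel p c u * laplaceQuotient a s u)
      (nhdsWithin 0 (Set.Ioi 0)) (nhds (∫ u in Set.Ioi (0:ℝ), cosKernel p c u *
        (Set.Ioi a).indicator (fun u => u / Real.sqrt (u ^ 2 - a ^ 2)) u)) := by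
  refine tendsto_integral_filter_of_dominated_convergence (kernelMajorant a p c)
    (Eventually.of_forall fun s =>
      ((measurable_cosKernel p c).mul (measurable_laplaceQuotient a s)).aestronglyMeasurable)
    ?_ (integrableOn_kernelMajorant ha hp c) ?_
  · filter_upwards [Ioc_mem_nhdsGT (zero_lt_one (α := ℝ))] with s hs
    filter_upwards [ae_restrict_Ioi_pos_and_ne a] with u hu
    exact norm_cosKernel_mul_laplaceQuotient_le ha hp hc hs.1.le hs.2 hu.1.le hu.2
  · filter_upwards [ae_restrict_Ioi_pos_and_ne a] with u hu
    exact (tendsto_laplaceQuotient ha hu.1 hu.2).const_mul _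

lemma integral_exp_neg_mul_div_sqrt {a : ℝ} (ha : 0 < a) (p : ℝ) :
    ∫ u in Set.Ioi a, Real.exp (-(p * u)) * (u / Real.sqrt (u ^ 2 - a ^ 2))
      = a * besselK 1 (a * p) := by
  have himage : (fun t => a * Real.cosh t) '' Set.Ioi 0 = Set.Ioi a := by
    ext u
    constructor
    · rintro ⟨t, ht, rfl⟩
      have := Real.one_lt_cosh.2 (ne_of_gt ht)
      simp only [Set.mem_Ioi]
      nlinarith
    · intro hu
      have hu' : 1 < u / a := (one_lt_div ha).2 hu
      refine ⟨Real.arcosh (u / a), Real.arcosh_pos hu', ?_⟩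
      simp only
      rw [Real.cosh_arcosh hu'.le]
      field_simp
  have hinj : Set.InjOn (fun t => a * Real.cosh t) (Set.Ioi 0) := fun x hx y hy hxy =>
    Real.cosh_strictMonoOn.injOn (Set.mem_Ici.2 (le_of_lt hx)) (Set.mem_Ici.2 (le_of_lt hy))
      (mul_left_cancel₀ ha.ne' hxy)
  have h := integral_image_eq_integral_abs_deriv_smul measurableSet_Ioi
    (fun t _ => ((Real.hasDerivAt_cosh t).const_mul a).hasDerivWithinAt) hinj
    (fun u => Real.exp (-(p * u)) * (u / Real.sqrt (u ^ 2 - a ^ 2)))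
  rw [himage] at h
  rw [h, besselK, ← integral_const_mul]
  refine setIntegral_congr_fun measurableSet_Ioi fun t ht => ?_
  have hs : 0 < Real.sinh t := Real.sinh_pos_iff.2 ht
  have hsqrt : Real.sqrt ((a * Real.cosh t) ^ 2 - a ^ 2) = a * Real.sinh t := by
    rw [show (a * Real.cosh t) ^ 2 - a ^ 2 = (a * Real.sinh t) ^ 2 by
      linear_combination a ^ 2 * Real.cosh_sq t, Real.sqrt_sq (by positivity)]
  simp only [hsqrt, smul_eq_mul, Nat.cast_one, one_mul]
  rw [abs_of_pos (by positivity), show p * (a * Real.cosh t) = a * p * Real.cosh t by ring]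
  field_simp

lemma integral_cosKernel_mul_indicator {a p c : ℝ} (ha : 0 < a) (hca : c < a) :
    ∫ u in Set.Ioi (0:ℝ), cosKernel p c u *
        (Set.Ioi a).indicator (fun u => u / Real.sqrt (u ^ 2 - a ^ 2)) u
      = -(a * (besselK 1 (a * p) * Real.sinh (p * c))) := by
  have e : ∀ u, cosKernel p c u * (Set.Ioi a).indicator (fun u => u / Real.sqrt (u ^ 2 - a ^ 2)) u
      = (Set.Ioi a).indicator (fun u => -Real.sinh (p * c) *
        (Real.exp (-(p * u)) * (u / Real.sqrt (u ^ 2 - a ^ 2)))) u := by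
    intro u
    by_cases hu : u ∈ Set.Ioi a
    · rw [Set.indicator_of_mem hu, Set.indicator_of_mem hu, cosKernel,
        if_neg (not_le.2 (hca.trans hu))]
      ring
    · rw [Set.indicator_of_notMem hu, Set.indicator_of_notMem hu, mul_zero]
  simp_rw [e]
  rw [setIntegral_indicator measurableSet_Ioi,
    Set.inter_eq_right.2 (Set.Ioi_subset_Ioi ha.le), integral_const_mul,
    integral_exp_neg_mul_div_sqrt ha]
  ring

lemma integral_exp_neg_mul_besselJ_one_mul_cos {a s : ℝ} (ha : 0 < a) (hs : 0 < s) (u : ℝ) :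
    ∫ τ in Set.Ioi (0:ℝ), Real.exp (-(s * τ)) * besselJ 1 (a * τ) * Real.cos (u * τ)
      = a⁻¹ * (1 - laplaceQuotient a s u) := by
  have hz : 0 < (s - u * Complex.I : ℂ).re := by simpa using hs
  have hint : Integrable (fun τ : ℝ => Complex.exp (-(s - u * Complex.I : ℂ) * τ)
      * (besselJ 1 (a * τ) : ℂ)) (volume.restrict (Set.Ioi 0)) :=
    (integrable_exp_neg_mul hz).mul_bdd (c := 1)
      (Complex.continuous_ofReal.comp (continuous_besselJ_one.comp
        (by fun_prop : Continuous fun τ : ℝ => a * τ))).aestronglyMeasurable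
      (Eventually.of_forall fun τ => by
        rw [Complex.norm_real]
        exact abs_besselJ_one_le_one _)
  have hre := integral_re hint
  rw [laplace_besselJ_one hz ha] at hre
  have e : ∀ τ : ℝ, Real.exp (-(s * τ)) * besselJ 1 (a * τ) * Real.cos (u * τ)
      = RCLike.re (Complex.exp (-(s - u * Complex.I : ℂ) * τ) * (besselJ 1 (a * τ) : ℂ)) := by
    intro τ
    rw [RCLike.re_to_complex, Complex.re_mul_ofReal, Complex.exp_re]
    simp
    ring
  simp_rw [e]
  rw [hre, laplaceQuotient, RCLike.re_to_complex, ← Complex.ofReal_inv, Complex.re_ofReal_mul,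
    Complex.sub_re, Complex.one_re]

lemma integral_exp_neg_mul_besselJ_one_mul_sin {a p c s : ℝ} (ha : 0 < a) (hp : 0 < p)
    (hc : 0 ≤ c) (hs : 0 < s) (hs1 : s ≤ 1) :
    ∫ τ in Set.Ioi (0:ℝ), Real.exp (-(s * τ)) *
        (τ / (τ ^ 2 + p ^ 2) * besselJ 1 (a * τ) * Real.sin (c * τ))
      = -(a⁻¹ * ∫ u in Set.Ioi (0:ℝ), cosKernel p c u * laplaceQuotient a s u) := by
  have hJ : Continuous fun τ : ℝ => besselJ 1 (a * τ) := continuous_besselJ_one.comp (by fun_prop)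
  have hint : Integrable (Function.uncurry fun τ u : ℝ =>
      Real.exp (-(s * τ)) * besselJ 1 (a * τ) * (cosKernel p c u * Real.cos (u * τ)))
      ((volume.restrict (Set.Ioi 0)).prod (volume.restrict (Set.Ioi 0))) := by
    have h := (integrableOn_exp_neg_mul hs 0).mul_prod (integrableOn_cosKernel hp hc)
    refine h.mono (Measurable.aestronglyMeasurable ?_) (Eventually.of_forall fun x => ?_)
    · unfold Function.uncurry
      have h1 : Measurable fun x : ℝ × ℝ => besselJ 1 (a * x.1) :=
        hJ.measurable.comp measurable_fst
      have h2 : Measurable fun x : ℝ × ℝ => cosKernel p c x.2 :=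
        (measurable_cosKernel p c).comp measurable_snd
      exact ((by fun_prop : Measurable fun x : ℝ × ℝ => Real.exp (-(s * x.1))).mul h1).mul
        (h2.mul (by fun_prop))
    · simp only [Function.uncurry, norm_mul]
      have h1 : ‖besselJ 1 (a * x.1)‖ ≤ 1 := abs_besselJ_one_le_one _
      have h2 : ‖Real.cos (x.2 * x.1)‖ ≤ 1 := Real.abs_cos_le_one _
      exact mul_le_mul (mul_le_of_le_one_right (norm_nonneg _) h1)
        (mul_le_of_le_one_right (norm_nonneg _) h2) (by positivity) (norm_nonneg _)
  have hswap := integral_integral_swap hint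
  have e1 : ∀ τ : ℝ, Real.exp (-(s * τ)) *
      (τ / (τ ^ 2 + p ^ 2) * besselJ 1 (a * τ) * Real.sin (c * τ))
      = ∫ u in Set.Ioi (0:ℝ),
        Real.exp (-(s * τ)) * besselJ 1 (a * τ) * (cosKernel p c u * Real.cos (u * τ)) := by
    intro τ
    rw [integral_const_mul, integral_cosKernel_mul_cos hp hc]
    ring
  have e2 : ∀ u : ℝ, ∫ τ in Set.Ioi (0:ℝ),
      Real.exp (-(s * τ)) * besselJ 1 (a * τ) * (cosKernel p c u * Real.cos (u * τ))
      = a⁻¹ * (cosKernel p c u - cosKernel p c u * laplaceQuotient a s u) := by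
    intro u
    have : ∀ τ : ℝ, Real.exp (-(s * τ)) * besselJ 1 (a * τ) * (cosKernel p c u * Real.cos (u * τ))
        = cosKernel p c u * (Real.exp (-(s * τ)) * besselJ 1 (a * τ) * Real.cos (u * τ)) :=
      fun τ => by ring
    simp_rw [this]
    rw [integral_const_mul, integral_exp_neg_mul_besselJ_one_mul_cos ha hs]
    ring
  have hzero : ∫ u in Set.Ioi (0:ℝ), cosKernel p c u = 0 := by
    simpa using integral_cosKernel_mul_cos hp hc 0
  simp_rw [e1]
  rw [hswap]
  simp_rw [e2]
  rw [integral_const_mul, integral_sub (integrableOn_cosKernel hp hc)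
    (integrableOn_cosKernel_mul_laplaceQuotient ha hp hc hs.le hs1), hzero]
  ring

lemma integral_div_mul_besselJ_one_mul_sin_of_nonneg {a p c : ℝ} (ha : 0 < a) (hp : 0 < p)
    (hc : 0 ≤ c) (hca : c < a) :
    ∫ τ in Set.Ioi (0:ℝ), τ / (τ ^ 2 + p ^ 2) * besselJ 1 (a * τ) * Real.sin (c * τ)
      = besselK 1 (a * p) * Real.sinh (p * c) := by
  have hF := integrableOn_div_mul_besselJ_one ha hp
  have hFs : IntegrableOn (fun τ => τ / (τ ^ 2 + p ^ 2) * besselJ 1 (a * τ) * Real.sin (c * τ))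
      (Set.Ioi 0) :=
    hF.mul_bdd (c := 1) (Continuous.aestronglyMeasurable (by fun_prop))
      (Eventually.of_forall fun u => Real.abs_sin_le_one _)
  have hleft : Tendsto (fun s => ∫ τ in Set.Ioi (0:ℝ), Real.exp (-(s * τ)) *
        (τ / (τ ^ 2 + p ^ 2) * besselJ 1 (a * τ) * Real.sin (c * τ)))
      (nhdsWithin 0 (Set.Ioi 0))
      (nhds (∫ τ in Set.Ioi (0:ℝ),
        τ / (τ ^ 2 + p ^ 2) * besselJ 1 (a * τ) * Real.sin (c * τ))) := by
    refine tendsto_integral_filter_of_dominated_convergence _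
      (Eventually.of_forall fun s => (Continuous.aestronglyMeasurable (by fun_prop)).mul hFs.1)
      ?_ hFs.norm (Eventually.of_forall fun τ => ?_)
    · filter_upwards [self_mem_nhdsWithin] with s hs
      filter_upwards [ae_restrict_mem measurableSet_Ioi] with τ hτ
      rw [norm_mul]
      refine mul_le_of_le_one_left (norm_nonneg _) ?_
      rw [Real.norm_of_nonneg (Real.exp_pos _).le, Real.exp_le_one_iff]
      have : 0 < s * τ := mul_pos hs hτ
      linarith
    · have : Continuous fun s : ℝ => Real.exp (-(s * τ)) *
        (τ / (τ ^ 2 + p ^ 2) * besselJ 1 (a * τ) * Real.sin (c * τ)) := by fun_prop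
      have h := (this.tendsto 0).mono_left (nhdsWithin_le_nhds (s := Set.Ioi 0))
      simpa using h
  have hright := ((tendsto_integral_cosKernel_mul_laplaceQuotient ha hp hc).const_mul a⁻¹).neg
  rw [integral_cosKernel_mul_indicator ha hca] at hright
  have heq := tendsto_nhds_unique (hleft.congr' (by
    filter_upwards [Ioc_mem_nhdsGT (zero_lt_one (α := ℝ))] with s hs
    exact integral_exp_neg_mul_besselJ_one_mul_sin ha hp hc hs.1 hs.2)) hright
  rw [heq]
  field_simp

lemma integral_div_mul_besselJ_one_mul_sin {a p c : ℝ} (ha : 0 < a) (hp : 0 < p)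
    (hca : |c| < a) :
    ∫ τ in Set.Ioi (0:ℝ), τ / (τ ^ 2 + p ^ 2) * besselJ 1 (a * τ) * Real.sin (c * τ)
      = besselK 1 (a * p) * Real.sinh (p * c) := by
  rcases le_total 0 c with hc | hc
  · exact integral_div_mul_besselJ_one_mul_sin_of_nonneg ha hp hc ((le_abs_self c).trans_lt hca)
  · have h := integral_div_mul_besselJ_one_mul_sin_of_nonneg ha hp (neg_nonneg.2 hc)
      ((neg_le_abs c).trans_lt hca)
    simp only [neg_mul, Real.sin_neg, mul_neg, Real.sinh_neg, integral_neg] at h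
    exact neg_injective h

theorem bessel_integral_formula_one (a b p : ℝ) (hab : b ≤ a) (hb : 0 < b) (hp : 0 < p) :
    ∫ τ in Set.Ioi (0:ℝ), τ / (τ ^ 2 + p ^ 2) * besselJ 1 (a * τ) * besselJ 1 (b * τ)
      = besselK 1 (a * p) * besselI 1 (b * p) := by
  have ha : 0 < a := hb.trans_le hab
  have hint : Integrable (Function.uncurry fun θ τ : ℝ =>
      τ / (τ ^ 2 + p ^ 2) * besselJ 1 (a * τ) * (Real.sin (b * τ * Real.cos θ) * Real.cos θ))
      ((volume.restrict (Set.uIoc 0 Real.pi)).prod (volume.restrict (Set.Ioi 0))) := by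
    have h1 : Integrable (fun _ : ℝ => (1 : ℝ)) (volume.restrict (Set.uIoc 0 Real.pi)) := by
      simp [Set.uIoc]
    have h := h1.mul_prod (integrableOn_div_mul_besselJ_one ha hp)
    simp only [one_mul] at h
    refine h.mul_bdd (c := 1)
      (Continuous.aestronglyMeasurable (by fun_prop)) (Eventually.of_forall fun x => ?_)
    rw [norm_mul]
    exact mul_le_one₀ (Real.abs_sin_le_one _) (norm_nonneg _) (Real.abs_cos_le_one _)
  have hswap := intervalIntegral_integral_swap hint
  have e1 : ∀ τ : ℝ, τ / (τ ^ 2 + p ^ 2) * besselJ 1 (a * τ) * besselJ 1 (b * τ)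
      = Real.pi⁻¹ * ∫ θ in (0:ℝ)..Real.pi, τ / (τ ^ 2 + p ^ 2) * besselJ 1 (a * τ) *
        (Real.sin (b * τ * Real.cos θ) * Real.cos θ) := by
    intro τ
    rw [intervalIntegral.integral_const_mul, besselJ_one_eq (b * τ)]
    ring
  have e2 : ∀ θ ∈ Set.Ioo 0 Real.pi, ∫ τ in Set.Ioi (0:ℝ), τ / (τ ^ 2 + p ^ 2) *
      besselJ 1 (a * τ) * (Real.sin (b * τ * Real.cos θ) * Real.cos θ)
      = besselK 1 (a * p) * (Real.sinh (b * p * Real.cos θ) * Real.cos θ) := by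
    intro θ hθ
    have hcos : |Real.cos θ| < 1 := by
      have h1 := Real.sin_pos_of_mem_Ioo hθ
      have h2 := Real.sin_sq_add_cos_sq θ
      exact (sq_lt_one_iff_abs_lt_one _).1 (by nlinarith)
    have hlt : |b * Real.cos θ| < a := by
      rw [abs_mul, abs_of_pos hb]
      nlinarith [abs_nonneg (Real.cos θ)]
    have : ∀ τ : ℝ, τ / (τ ^ 2 + p ^ 2) * besselJ 1 (a * τ) *
        (Real.sin (b * τ * Real.cos θ) * Real.cos θ)
        = τ / (τ ^ 2 + p ^ 2) * besselJ 1 (a * τ) * Real.sin (b * Real.cos θ * τ)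
          * Real.cos θ := by
      intro τ
      rw [show b * τ * Real.cos θ = b * Real.cos θ * τ by ring]
      ring
    simp_rw [this]
    rw [integral_mul_const, integral_div_mul_besselJ_one_mul_sin ha hp hlt,
      show p * (b * Real.cos θ) = b * p * Real.cos θ by ring]
    ring
  simp_rw [e1]
  rw [integral_const_mul, ← hswap, besselI_one_eq, intervalIntegral.integral_of_le Real.pi_pos.le,
    integral_Ioc_eq_integral_Ioo, setIntegral_congr_fun measurableSet_Ioo e2, integral_const_mul,
    intervalIntegral.integral_of_le Real.pi_pos.le, integral_Ioc_eq_integral_Ioo]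
  ring
end

section
/- Let G(r) = (-1/(4π²)) · (2 I₁(r) K₁(r) + 2 I₂(r) K₀(r) - 1) / (I₁(r)² - I₀(r) I₂(r)) for r > 0. Then G(r) + (1/(2π²)) log r converges to a finite limit as r ↓ 0; in particular G(r) ~ -(1/(2π²)) log r as r ↓ 0. -/
open MeasureTheory Filter

/-- The variance function G. -/
noncomputable def Gfun (r : ℝ) : ℝ :=
  (-(1 / (4 * Real.pi ^ 2))) *
    ((2 * besselI 1 r * besselK 1 r + 2 * besselI 2 r * besselK 0 r - 1) /
      (besselI 1 r ^ 2 - besselI 0 r * besselI 2 r))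

open Set Topology

/-- Second-order Taylor remainder of `exp` along a ray. -/
lemma tendsto_exp_mul_sub_one_sub_div_sq (c : ℝ) :
    Tendsto (fun r : ℝ => (Real.exp (r * c) - 1 - r * c) / r ^ 2) (𝓝[>] 0) (𝓝 (c ^ 2 / 2)) := by
  have hsmall : ∀ᶠ r : ℝ in 𝓝[>] 0, |r * c| ≤ 1 := by
    have h : Tendsto (fun r : ℝ => |r * c|) (𝓝[>] 0) (𝓝 0) := by
      have : Continuous fun r : ℝ => |r * c| := by fun_prop
      simpa using (this.tendsto 0).mono_left nhdsWithin_le_nhds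
    exact (h.eventually (gt_mem_nhds one_pos)).mono fun _ hr => hr.le
  have hlim : Tendsto (fun r : ℝ => |c| ^ 3 * r) (𝓝[>] 0) (𝓝 0) := by
    have : Continuous fun r : ℝ => |c| ^ 3 * r := by fun_prop
    simpa using (this.tendsto 0).mono_left nhdsWithin_le_nhds
  rw [tendsto_iff_norm_sub_tendsto_zero]
  refine squeeze_zero' (Eventually.of_forall fun _ => norm_nonneg _) ?_ hlim
  filter_upwards [hsmall, self_mem_nhdsWithin] with r hr hr0
  have hr0 : 0 < r := hr0
  have h := Real.exp_bound hr (n := 3) (by norm_num)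
  norm_num [Finset.sum_range_succ, Nat.factorial] at h
  have e : (Real.exp (r * c) - 1 - r * c) / r ^ 2 - c ^ 2 / 2
      = (Real.exp (r * c) - (1 + r * c + (r * c) ^ 2 / 2)) / r ^ 2 := by
    field_simp
    ring
  rw [e, norm_div, Real.norm_eq_abs, Real.norm_eq_abs, abs_of_pos (pow_pos hr0 2),
    div_le_iff₀ (by positivity)]
  have h3 : |r| * |c| = r * |c| := by rw [abs_of_pos hr0]
  rw [h3] at h
  have : 0 ≤ (r * |c|) ^ 3 := by positivity
  nlinarith

lemma integral_cos_mul_sin_pow_eq_zero (m : ℕ) :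
    ∫ θ in (0:ℝ)..Real.pi, Real.cos θ * Real.sin θ ^ m = 0 := by
  have h := integral_sin_pow_mul_cos_pow_odd (a := 0) (b := Real.pi) m 0
  simpa [mul_comm] using h

/-- The integral in the definition of `besselI` is even in `r` to second order. -/
lemma tendsto_integral_exp_cos_sub_div_sq (k : ℕ) :
    ∃ L : ℝ, Tendsto (fun r : ℝ =>
      ((∫ θ in (0:ℝ)..Real.pi, Real.exp (r * Real.cos θ) * Real.sin θ ^ (2 * k))
        - ∫ θ in (0:ℝ)..Real.pi, Real.sin θ ^ (2 * k)) / r ^ 2) (𝓝[>] 0) (𝓝 L) := by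
  refine ⟨∫ θ in (0:ℝ)..Real.pi, Real.cos θ ^ 2 / 2 * Real.sin θ ^ (2 * k), ?_⟩
  have hdct : Tendsto (fun r : ℝ => ∫ θ in (0:ℝ)..Real.pi,
      (Real.exp (r * Real.cos θ) - 1 - r * Real.cos θ) / r ^ 2 * Real.sin θ ^ (2 * k))
      (𝓝[>] 0) (𝓝 (∫ θ in (0:ℝ)..Real.pi, Real.cos θ ^ 2 / 2 * Real.sin θ ^ (2 * k))) := by
    refine intervalIntegral.tendsto_integral_filter_of_dominated_convergence (fun _ => (1:ℝ))
      (Eventually.of_forall fun r => ?_) ?_ (by simp) ?_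
    · exact (by fun_prop : Continuous fun θ : ℝ =>
        (Real.exp (r * Real.cos θ) - 1 - r * Real.cos θ) / r ^ 2
          * Real.sin θ ^ (2 * k)).aestronglyMeasurable
    · filter_upwards [Ioo_mem_nhdsGT (one_pos (α := ℝ))] with r hr
      refine ae_of_all _ fun θ _ => ?_
      have hr0 : 0 < r := hr.1
      have hc := Real.abs_cos_le_one θ
      have hx : |r * Real.cos θ| ≤ 1 := by
        rw [abs_mul, abs_of_pos hr0]
        exact mul_le_one₀ hr.2.le (abs_nonneg _) hc
      have h := Real.abs_exp_sub_one_sub_id_le hx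
      have hs : |Real.sin θ| ^ (2 * k) ≤ 1 := pow_le_one₀ (abs_nonneg _) (Real.abs_sin_le_one θ)
      rw [norm_mul, norm_div, norm_pow, Real.norm_eq_abs, Real.norm_eq_abs, Real.norm_eq_abs,
        abs_pow, abs_of_pos hr0]
      refine mul_le_one₀ ?_ (by positivity) hs
      rw [div_le_one (by positivity)]
      refine h.trans ?_
      nlinarith [Real.cos_sq_le_one θ, sq_nonneg r]
    · exact ae_of_all _ fun θ _ =>
        (tendsto_exp_mul_sub_one_sub_div_sq (Real.cos θ)).mul_const _
  refine hdct.congr' ?_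
  filter_upwards [self_mem_nhdsWithin] with r hr
  have hr0 : (r : ℝ) ≠ 0 := ne_of_gt hr
  have i1 : IntervalIntegrable (fun θ => Real.exp (r * Real.cos θ) * Real.sin θ ^ (2 * k))
      volume 0 Real.pi := (by fun_prop : Continuous _).intervalIntegrable _ _
  have i2 : IntervalIntegrable (fun θ => Real.sin θ ^ (2 * k)) volume 0 Real.pi :=
    (by fun_prop : Continuous _).intervalIntegrable _ _
  have i3 : IntervalIntegrable (fun θ => r * (Real.cos θ * Real.sin θ ^ (2 * k)))
      volume 0 Real.pi := (by fun_prop : Continuous _).intervalIntegrable _ _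
  have e : ∀ θ : ℝ, (Real.exp (r * Real.cos θ) - 1 - r * Real.cos θ) / r ^ 2
        * Real.sin θ ^ (2 * k)
      = (Real.exp (r * Real.cos θ) * Real.sin θ ^ (2 * k) - Real.sin θ ^ (2 * k)
          - r * (Real.cos θ * Real.sin θ ^ (2 * k))) / r ^ 2 := fun θ => by ring
  simp_rw [e]
  rw [intervalIntegral.integral_div, intervalIntegral.integral_sub (i1.sub i2) i3,
    intervalIntegral.integral_sub i1 i2, intervalIntegral.integral_const_mul,
    integral_cos_mul_sin_pow_eq_zero, mul_zero, sub_zero]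

/-- If `c` normalizes the integral in `besselI k` to be `1` at `r = 0`, then
`besselI k r = p r ^ k (1 + r ^ 2 α r)` with `α` convergent at `0`. -/
lemma besselI_normalized_expansion (k : ℕ) (c p : ℝ)
    (hc : c * (Real.pi * ∏ i ∈ Finset.range k, (2 * (i : ℝ) + 1) / (2 * i + 2)) = 1)
    (hI : ∀ r, besselI k r = p * r ^ k *
      (c * ∫ θ in (0:ℝ)..Real.pi, Real.exp (r * Real.cos θ) * Real.sin θ ^ (2 * k))) :
    ∃ (α : ℝ → ℝ) (L : ℝ), Tendsto α (𝓝[>] 0) (𝓝 L) ∧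
      ∀ r > 0, besselI k r = p * r ^ k * (1 + r ^ 2 * α r) := by
  obtain ⟨L, hL⟩ := tendsto_integral_exp_cos_sub_div_sq k
  refine ⟨_, _, hL.const_mul c, fun r hr => ?_⟩
  rw [hI, integral_sin_pow_even]
  congr 1
  rw [mul_left_comm, mul_div_cancel₀ _ (pow_ne_zero 2 hr.ne')]
  linear_combination hc

lemma besselI_zero_expansion : ∃ (α : ℝ → ℝ) (L : ℝ), Tendsto α (𝓝[>] 0) (𝓝 L) ∧
    ∀ r > 0, besselI 0 r = 1 + r ^ 2 * α r := by
  have hs : √Real.pi * √Real.pi = Real.pi := Real.mul_self_sqrt Real.pi_pos.le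
  obtain ⟨α, L, h, h'⟩ := besselI_normalized_expansion 0 (1 / Real.pi) 1
    (by simp [Real.pi_ne_zero]) fun r => by
      rw [besselI, Real.Gamma_nat_add_half, mul_div_assoc']
      simp [Nat.doubleFactorial, hs]
  exact ⟨α, L, h, fun r hr => by simpa using h' r hr⟩

lemma besselI_one_expansion : ∃ (α : ℝ → ℝ) (L : ℝ), Tendsto α (𝓝[>] 0) (𝓝 L) ∧
    ∀ r > 0, besselI 1 r = r / 2 * (1 + r ^ 2 * α r) := by
  have hs : √Real.pi * √Real.pi = Real.pi := Real.mul_self_sqrt Real.pi_pos.le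
  have hp := Real.pi_ne_zero
  obtain ⟨α, L, h, h'⟩ := besselI_normalized_expansion 1 (2 / Real.pi) (1 / 2)
    (by norm_num; field_simp) fun r => by
      rw [besselI, Real.Gamma_nat_add_half]
      norm_num [Nat.doubleFactorial]
      rw [mul_div_assoc', hs]
      field_simp
  exact ⟨α, L, h, fun r hr => by rw [h' r hr]; ring⟩

lemma besselI_two_expansion : ∃ (α : ℝ → ℝ) (L : ℝ), Tendsto α (𝓝[>] 0) (𝓝 L) ∧
    ∀ r > 0, besselI 2 r = r ^ 2 / 8 * (1 + r ^ 2 * α r) := by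
  have hs : √Real.pi * √Real.pi = Real.pi := Real.mul_self_sqrt Real.pi_pos.le
  have hp := Real.pi_ne_zero
  obtain ⟨α, L, h, h'⟩ := besselI_normalized_expansion 2 (8 / (3 * Real.pi)) (1 / 8)
    (by norm_num [Finset.prod_range_succ]; field_simp) fun r => by
      rw [besselI, Real.Gamma_nat_add_half]
      norm_num [Nat.doubleFactorial]
      rw [mul_div_assoc', mul_left_comm, hs]
      field_simp
      norm_num
  exact ⟨α, L, h, fun r hr => by rw [h' r hr]; ring⟩

lemma integrableOn_exp_neg_sinh_mul_cosh {r : ℝ} (hr : 0 < r) :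
    IntegrableOn (fun t => Real.exp (-(r * Real.sinh t)) * Real.cosh t) (Ioi 0) ∧
    ∫ t in Ioi (0:ℝ), Real.exp (-(r * Real.sinh t)) * Real.cosh t = 1 / r := by
  have hd : ∀ t ∈ Ici (0:ℝ), HasDerivAt (fun t => -(1 / r) * Real.exp (-(r * Real.sinh t)))
      (Real.exp (-(r * Real.sinh t)) * Real.cosh t) t := fun t _ => by
    refine ((((Real.hasDerivAt_sinh t).const_mul r).fun_neg.exp).const_mul
      (-(1 / r))).congr_deriv ?_
    field_simp
  have hpos : ∀ t ∈ Ioi (0:ℝ), 0 ≤ Real.exp (-(r * Real.sinh t)) * Real.cosh t := fun t _ =>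
    mul_nonneg (Real.exp_pos _).le (Real.cosh_pos _).le
  have hsinh : Tendsto Real.sinh atTop atTop :=
    tendsto_atTop_mono' _ ((eventually_ge_atTop 0).mono fun t ht => Real.self_le_sinh_iff.2 ht)
      tendsto_id
  have hl : Tendsto (fun t => -(1 / r) * Real.exp (-(r * Real.sinh t))) atTop (𝓝 0) := by
    have := (Real.tendsto_exp_neg_atTop_nhds_zero.comp
      (hsinh.const_mul_atTop hr)).const_mul (-(1 / r))
    simpa using this
  refine ⟨integrableOn_Ioi_deriv_of_nonneg' hd hpos hl, ?_⟩
  rw [integral_Ioi_of_hasDerivAt_of_nonneg' hd hpos hl]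
  simp

lemma integrableOn_exp_neg_cosh_mul_cosh {r : ℝ} (hr : 0 < r) :
    IntegrableOn (fun t => Real.exp (-(r * Real.cosh t)) * Real.cosh t) (Ioi 0) := by
  refine (integrableOn_exp_neg_sinh_mul_cosh hr).1.mono'
    (by fun_prop : Continuous _).aestronglyMeasurable (ae_of_all _ fun t => ?_)
  have hc := Real.cosh_pos t
  rw [Real.norm_of_nonneg (by positivity)]
  gcongr
  exact (Real.sinh_lt_cosh t).le

lemma integrableOn_exp_neg_cosh {r : ℝ} (hr : 0 < r) :
    IntegrableOn (fun t => Real.exp (-(r * Real.cosh t))) (Ioi 0) := by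
  refine (integrableOn_exp_neg_cosh_mul_cosh hr).mono'
    (by fun_prop : Continuous _).aestronglyMeasurable (ae_of_all _ fun t => ?_)
  rw [Real.norm_of_nonneg (Real.exp_pos _).le]
  exact le_mul_of_one_le_right (Real.exp_pos _).le (Real.one_le_cosh t)

lemma mul_cosh_sub_log {r : ℝ} (hr : 0 < r) (s : ℝ) :
    r * Real.cosh (s - Real.log r) = (Real.exp s + r ^ 2 * Real.exp (-s)) / 2 := by
  rw [Real.cosh_eq, neg_sub, Real.exp_sub, Real.exp_sub, Real.exp_log hr, Real.exp_neg]
  field_simp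

/-- `K₀(r) + log r` as an integral over the line, after the shift `t = s - log r`. -/
lemma besselK_zero_add_log {r : ℝ} (hr : 0 < r) (hr1 : r < 1) :
    besselK 0 r + Real.log r = ∫ s : ℝ,
      ((Ioi (Real.log r)).indicator (fun s => Real.exp (-(r * Real.cosh (s - Real.log r)))) s
        - (Ioc (Real.log r) 0).indicator (fun _ => (1:ℝ)) s) := by
  have hlog : Real.log r < 0 := Real.log_neg hr hr1
  have hshift : ((Ioi (Real.log r)).indicator fun s =>
      Real.exp (-(r * Real.cosh (s - Real.log r)))) =
      fun s => (Ioi (0:ℝ)).indicator (fun t => Real.exp (-(r * Real.cosh t))) (s - Real.log r) := by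
    ext s
    simp [indicator, sub_pos]
  have hint : Integrable ((Ioi (Real.log r)).indicator fun s =>
      Real.exp (-(r * Real.cosh (s - Real.log r)))) := by
    rw [hshift]
    exact ((integrable_indicator_iff measurableSet_Ioi).2
      (integrableOn_exp_neg_cosh hr)).comp_sub_right _
  have hone : Integrable ((Ioc (Real.log r) 0).indicator fun _ => (1:ℝ)) :=
    (integrable_indicator_iff measurableSet_Ioc).2 (by simp)
  rw [integral_sub hint hone, integral_indicator measurableSet_Ioc, hshift,
    integral_sub_right_eq_self (fun t => (Ioi (0:ℝ)).indicator
      (fun t => Real.exp (-(r * Real.cosh t))) t), integral_indicator measurableSet_Ioi]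
  simp [besselK, hlog.le]

lemma tendsto_besselK_zero_add_log :
    ∃ L : ℝ, Tendsto (fun r => besselK 0 r + Real.log r) (𝓝[>] 0) (𝓝 L) := by
  refine ⟨∫ s : ℝ, (Real.exp (-(Real.exp s / 2)) - (Iic (0:ℝ)).indicator (fun _ => (1:ℝ)) s), ?_⟩
  have hdct : Tendsto (fun r : ℝ => ∫ s : ℝ,
      ((Ioi (Real.log r)).indicator (fun s => Real.exp (-(r * Real.cosh (s - Real.log r)))) s
        - (Ioc (Real.log r) 0).indicator (fun _ => (1:ℝ)) s)) (𝓝[>] 0)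
      (𝓝 (∫ s : ℝ, (Real.exp (-(Real.exp s / 2))
        - (Iic (0:ℝ)).indicator (fun _ => (1:ℝ)) s))) := by
    refine tendsto_integral_filter_of_dominated_convergence
      (fun s => (Iic (0:ℝ)).indicator (fun s => Real.exp s) s
        + (Ioi (0:ℝ)).indicator (fun s => Real.exp (-(1 / 2) * s)) s) ?_ ?_ ?_ ?_
    · refine Eventually.of_forall fun r => Measurable.aestronglyMeasurable ?_
      exact ((by fun_prop : Measurable fun s =>
        Real.exp (-(r * Real.cosh (s - Real.log r)))).indicator measurableSet_Ioi).sub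
        (measurable_const.indicator measurableSet_Ioc)
    · filter_upwards [Ioo_mem_nhdsGT (one_pos (α := ℝ))] with r hr
      refine ae_of_all _ fun s => ?_
      have hr0 : 0 < r := hr.1
      have hlog : Real.log r < 0 := Real.log_neg hr.1 hr.2
      have hcosh := mul_cosh_sub_log hr0 s
      have hrem : 0 ≤ r ^ 2 * Real.exp (-s) := by positivity
      rcases le_or_gt s 0 with hs | hs
      · rcases le_or_gt s (Real.log r) with hsr | hsr
        · simp [indicator, hs, hsr.not_gt, hs.not_gt, (Real.exp_pos s).le]
        · have hrs : r < Real.exp s := (Real.log_lt_iff_lt_exp hr0).1 hsr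
          have h1 : r ^ 2 * Real.exp (-s) ≤ Real.exp s := by
            rw [Real.exp_neg, ← div_eq_mul_inv, div_le_iff₀ (Real.exp_pos s)]
            nlinarith
          have h2 := Real.add_one_le_exp (-((Real.exp s + r ^ 2 * Real.exp (-s)) / 2))
          have h3 : Real.exp (-((Real.exp s + r ^ 2 * Real.exp (-s)) / 2)) ≤ 1 :=
            Real.exp_le_one_iff.2 (by linarith [Real.exp_pos s])
          simp only [indicator, mem_Ioi, hsr, mem_Ioc, hs, mem_Iic, hs.not_gt, and_self, if_true,
            if_false, hcosh, Real.norm_eq_abs, add_zero]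
          rw [abs_le]
          constructor <;> linarith [Real.exp_pos s]
      · have hsr : Real.log r < s := hlog.trans hs
        simp only [indicator, mem_Ioi, hsr, mem_Ioc, mem_Iic, hs.not_ge, hs, and_false, if_true,
            if_false, hcosh, sub_zero, zero_add]
        rw [Real.norm_of_nonneg (Real.exp_pos _).le]
        refine Real.exp_le_exp.2 ?_
        linarith [Real.add_one_le_exp s]
    · exact ((integrable_indicator_iff measurableSet_Iic).2 (integrableOn_exp_Iic 0)).add
        ((integrable_indicator_iff measurableSet_Ioi).2
          (exp_neg_integrableOn_Ioi 0 (by norm_num)))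
    · refine ae_of_all _ fun s => ?_
      have hlim : Tendsto (fun r : ℝ => Real.exp (-((Real.exp s + r ^ 2 * Real.exp (-s)) / 2))
          - (Iic (0:ℝ)).indicator (fun _ => (1:ℝ)) s) (𝓝[>] 0)
          (𝓝 (Real.exp (-(Real.exp s / 2)) - (Iic (0:ℝ)).indicator (fun _ => (1:ℝ)) s)) := by
        have : Continuous fun r : ℝ => Real.exp (-((Real.exp s + r ^ 2 * Real.exp (-s)) / 2))
          - (Iic (0:ℝ)).indicator (fun _ => (1:ℝ)) s := by fun_prop
        simpa using (this.tendsto 0).mono_left nhdsWithin_le_nhds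
      refine hlim.congr' ?_
      filter_upwards [self_mem_nhdsWithin,
        Real.tendsto_log_nhdsGT_zero.eventually (eventually_lt_atBot s)] with r hr hsr
      simp [indicator, hsr, mul_cosh_sub_log hr]
  refine hdct.congr' ?_
  filter_upwards [Ioo_mem_nhdsGT (one_pos (α := ℝ))] with r hr
  exact (besselK_zero_add_log hr.1 hr.2).symm

/-- `K₁(r) - 1/r + (r/2) K₀(r)`, divided by `r`, as one integral. -/
lemma besselK_one_sub_inv_div {r : ℝ} (hr : 0 < r) :
    (besselK 1 r - 1 / r) / r + besselK 0 r / 2 = ∫ t in Ioi (0:ℝ),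
      Real.exp (-(r * Real.cosh t)) *
        (1 / 2 - Real.cosh t * ((Real.exp (r * Real.exp (-t)) - 1) / r)) := by
  have e : ∀ t : ℝ, Real.exp (-(r * Real.cosh t)) *
        (1 / 2 - Real.cosh t * ((Real.exp (r * Real.exp (-t)) - 1) / r))
      = (Real.exp (-(r * Real.cosh t)) * Real.cosh t
          - Real.exp (-(r * Real.sinh t)) * Real.cosh t) / r
        + Real.exp (-(r * Real.cosh t)) / 2 := fun t => by
    have : Real.exp (-(r * Real.sinh t))
        = Real.exp (-(r * Real.cosh t)) * Real.exp (r * Real.exp (-t)) := by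
      rw [← Real.exp_add, ← Real.cosh_sub_sinh t]
      congr 1
      ring
    rw [this]
    ring
  simp_rw [e]
  have i1 := integrableOn_exp_neg_cosh_mul_cosh hr
  have i2 := integrableOn_exp_neg_sinh_mul_cosh hr
  have i3 : IntegrableOn (fun t => (Real.exp (-(r * Real.cosh t)) * Real.cosh t
      - Real.exp (-(r * Real.sinh t)) * Real.cosh t) / r) (Ioi 0) := (i1.sub i2.1).div_const r
  rw [integral_add i3 ((integrableOn_exp_neg_cosh hr).div_const 2),
    integral_div, integral_div, integral_sub i1 i2.1, i2.2]
  simp [besselK]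

lemma tendsto_besselK_one_sub_inv_div :
    ∃ L : ℝ, Tendsto (fun r => (besselK 1 r - 1 / r) / r + besselK 0 r / 2)
      (𝓝[>] 0) (𝓝 L) := by
  refine ⟨∫ t in Ioi (0:ℝ), 1 * (1 / 2 - Real.cosh t * Real.exp (-t)), ?_⟩
  have hdct : Tendsto (fun r : ℝ => ∫ t in Ioi (0:ℝ), Real.exp (-(r * Real.cosh t)) *
        (1 / 2 - Real.cosh t * ((Real.exp (r * Real.exp (-t)) - 1) / r))) (𝓝[>] 0)
      (𝓝 (∫ t in Ioi (0:ℝ), 1 * (1 / 2 - Real.cosh t * Real.exp (-t)))) := by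
    refine tendsto_integral_filter_of_dominated_convergence
      (fun t => 2 * Real.exp (-1 * t)) ?_ ?_ ?_ ?_
    · exact Eventually.of_forall fun r => (by fun_prop : Continuous _).aestronglyMeasurable
    · filter_upwards [Ioo_mem_nhdsGT (one_pos (α := ℝ))] with r hr
      refine (ae_restrict_iff' measurableSet_Ioi).2 (ae_of_all _ fun t ht => ?_)
      have ht : 0 < t := ht
      have hr0 : 0 < r := hr.1
      have hu0 := Real.exp_pos (-t)
      have hu1 : Real.exp (-t) ≤ 1 := Real.exp_le_one_iff.2 (by linarith)
      have hcu : Real.cosh t * Real.exp (-t) = (1 + Real.exp (-t) ^ 2) / 2 := by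
        rw [Real.cosh_eq, Real.exp_neg]
        field_simp
      have hx : |r * Real.exp (-t)| ≤ 1 := by
        rw [abs_of_pos (by positivity)]
        exact mul_le_one₀ hr.2.le hu0.le hu1
      have hq := Real.abs_exp_sub_one_sub_id_le hx
      have hq0 := Real.add_one_le_exp (r * Real.exp (-t))
      rw [abs_le] at hq
      set q := (Real.exp (r * Real.exp (-t)) - 1) / r with hqdef
      have hq1 : Real.exp (-t) ≤ q := by
        rw [hqdef, le_div_iff₀ hr0]
        linarith
      have hq2 : q ≤ Real.exp (-t) + Real.exp (-t) ^ 2 := by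
        rw [hqdef, div_le_iff₀ hr0]
        have : (r * Real.exp (-t)) ^ 2 ≤ r * Real.exp (-t) ^ 2 := by
          rw [mul_pow]
          exact mul_le_mul_of_nonneg_right (by nlinarith [hr.2]) (by positivity)
        linarith
      have hc := Real.cosh_pos t
      have l1 : Real.cosh t * Real.exp (-t) ≤ Real.cosh t * q := by gcongr
      have l2 : Real.cosh t * q ≤ Real.cosh t * (Real.exp (-t) + Real.exp (-t) ^ 2) := by gcongr
      have l3 : Real.cosh t * (Real.exp (-t) + Real.exp (-t) ^ 2)
          = (1 + Real.exp (-t) ^ 2) / 2 * (1 + Real.exp (-t)) := by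
        rw [← hcu]; ring
      have hE : Real.exp (-(r * Real.cosh t)) ≤ 1 :=
        Real.exp_le_one_iff.2 (by have := mul_pos hr0 hc; linarith)
      rw [norm_mul, Real.norm_of_nonneg (Real.exp_pos _).le, Real.norm_eq_abs, neg_one_mul]
      have hb : |1 / 2 - Real.cosh t * q| ≤ 2 * Real.exp (-t) := by
        have : Real.exp (-t) ^ 2 ≤ Real.exp (-t) := by nlinarith
        rw [abs_le]
        constructor <;> nlinarith
      calc _ ≤ 1 * |1 / 2 - Real.cosh t * q| := by gcongr
        _ ≤ _ := by rwa [one_mul]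
    · exact (exp_neg_integrableOn_Ioi 0 one_pos).const_mul 2
    · refine ae_of_all _ fun t => ?_
      have h1 : Tendsto (fun r : ℝ => Real.exp (-(r * Real.cosh t))) (𝓝[>] 0) (𝓝 1) := by
        have : Continuous fun r : ℝ => Real.exp (-(r * Real.cosh t)) := by fun_prop
        simpa using (this.tendsto 0).mono_left nhdsWithin_le_nhds
      have h2 : Tendsto (fun r : ℝ => (Real.exp (r * Real.exp (-t)) - 1) / r) (𝓝[>] 0)
          (𝓝 (Real.exp (-t))) := by
        have hd : HasDerivAt (fun r : ℝ => Real.exp (r * Real.exp (-t))) (Real.exp (-t)) 0 := by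
          simpa using ((hasDerivAt_id (0:ℝ)).mul_const (Real.exp (-t))).exp
        simpa [div_eq_inv_mul] using hd.tendsto_slope_zero_right
      exact h1.mul ((h2.const_mul _).const_sub _)
  refine hdct.congr' ?_
  filter_upwards [self_mem_nhdsWithin] with r hr
  exact (besselK_one_sub_inv_div hr).symm

lemma tendsto_Gfun_add_log :
    ∃ L : ℝ, Tendsto (fun r => Gfun r + (1 / (2 * Real.pi ^ 2)) * Real.log r)
      (𝓝[>] 0) (𝓝 L) := by
  obtain ⟨α₀, A₀, hα₀, h₀⟩ := besselI_zero_expansion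
  obtain ⟨α₁, A₁, hα₁, h₁⟩ := besselI_one_expansion
  obtain ⟨α₂, A₂, hα₂, h₂⟩ := besselI_two_expansion
  obtain ⟨B₀, hB₀⟩ := tendsto_besselK_zero_add_log
  obtain ⟨B₁, hB₁⟩ := tendsto_besselK_one_sub_inv_div
  have hsq : Tendsto (fun r : ℝ => r ^ 2) (𝓝[>] 0) (𝓝 0) := by
    simpa using ((continuous_pow 2).tendsto (0:ℝ)).mono_left nhdsWithin_le_nhds
  have hlog : Tendsto (fun r : ℝ => Real.log r * r ^ 2) (𝓝[>] 0) (𝓝 0) := by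
    simpa using tendsto_log_mul_rpow_nhdsGT_zero (r := 2) two_pos
  have ha : ∀ {α : ℝ → ℝ} {A : ℝ}, Tendsto α (𝓝[>] 0) (𝓝 A) →
      Tendsto (fun r => 1 + r ^ 2 * α r) (𝓝[>] 0) (𝓝 1) := fun h => by
    simpa using (hsq.mul h).const_add 1
  have ha₀ := ha hα₀
  have ha₁ := ha hα₁
  have ha₂ := ha hα₂
  have hd : Tendsto (fun r => (1 + r ^ 2 * α₁ r) ^ 2 / 4
      - (1 + r ^ 2 * α₀ r) * (1 + r ^ 2 * α₂ r) / 8) (𝓝[>] 0) (𝓝 (1 / 8)) := by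
    convert ((ha₁.pow 2).div_const 4).sub ((ha₀.mul ha₂).div_const 8) using 2
    norm_num
  have hlead := hlog.mul (((ha₂.mul hα₀).div_const 4).sub ((ha₁.mul hα₁).div_const 2))
  have hrest := (hα₁.add (ha₁.mul (hB₁.sub (hB₀.div_const 2)))).add
    ((ha₂.mul hB₀).div_const 4)
  refine ⟨_, (((hlead.add hrest).div hd (by norm_num)).const_mul
    (-(1 / (4 * Real.pi ^ 2)))).congr' ?_⟩
  filter_upwards [self_mem_nhdsWithin, hd.eventually_ne (by norm_num : (1 / 8 : ℝ) ≠ 0)]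
    with r hr hdr
  have hr0 : r ≠ 0 := ne_of_gt hr
  have hp := Real.pi_ne_zero
  rw [Gfun, h₀ r hr, h₁ r hr, h₂ r hr]
  have hden : (r / 2 * (1 + r ^ 2 * α₁ r)) ^ 2
      - (1 + r ^ 2 * α₀ r) * (r ^ 2 / 8 * (1 + r ^ 2 * α₂ r))
      = r ^ 2 * ((1 + r ^ 2 * α₁ r) ^ 2 / 4
      - (1 + r ^ 2 * α₀ r) * (1 + r ^ 2 * α₂ r) / 8) := by ring
  rw [hden]
  set d := (1 + r ^ 2 * α₁ r) ^ 2 / 4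
      - (1 + r ^ 2 * α₀ r) * (1 + r ^ 2 * α₂ r) / 8 with hddef
  have hlog' : (1 / (2 * Real.pi ^ 2)) * Real.log r
      = -(1 / (4 * Real.pi ^ 2)) * (-(2 * Real.log r)) := by
    field_simp
    ring
  rw [hlog', ← mul_add]
  congr 1
  rw [Pi.div_apply, ← hddef, ← sub_eq_add_neg, eq_sub_iff_add_eq, div_add' _ _ _ hdr,
    div_eq_div_iff hdr (mul_ne_zero (pow_ne_zero 2 hr0) hdr)]
  simp only [hddef]
  field_simp
  ring

theorem Gfun_log_asymptotics :
    (∃ L : ℝ, Tendsto (fun r => Gfun r + (1 / (2 * Real.pi ^ 2)) * Real.log r)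
      (nhdsWithin 0 (Set.Ioi 0)) (nhds L))
    ∧ Tendsto (fun r => Gfun r / (-(1 / (2 * Real.pi ^ 2)) * Real.log r))
        (nhdsWithin 0 (Set.Ioi 0)) (nhds 1) := by
  refine ⟨tendsto_Gfun_add_log, ?_⟩
  obtain ⟨L, hL⟩ := tendsto_Gfun_add_log
  have hc : (0:ℝ) < 1 / (2 * Real.pi ^ 2) := by have := Real.pi_pos; positivity
  have htop : Tendsto (fun r => -(1 / (2 * Real.pi ^ 2)) * Real.log r) (𝓝[>] 0) atTop :=
    Real.tendsto_log_nhdsGT_zero.const_mul_atBot_of_neg (neg_lt_zero.2 hc)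
  have h := (hL.div_atTop htop).const_add 1
  rw [add_zero] at h
  refine h.congr' ?_
  filter_upwards [htop.eventually_gt_atTop 0] with r hr
  rw [one_add_div hr.ne']
  congr 1
  ring
end

section
/- Let G(r) = (-1/(4π²)) · (2 I₁(r) K₁(r) + 2 I₂(r) K₀(r) - 1)/(I₁(r)² - I₀(r) I₂(r)). Then G is strictly decreasing on (0,∞) with G(r) → +∞ as r ↓ 0 and G(r) → 0 as r → ∞. -/
open MeasureTheory Filter

open Set Topology

/-- The integral in the Poisson representation of `besselI k`. -/
noncomputable def poissonIntegral (k : ℕ) (r : ℝ) : ℝ :=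
  ∫ θ in (0:ℝ)..Real.pi, Real.exp (r * Real.cos θ) * Real.sin θ ^ (2 * k)

/-- The moments `∫ cosh t ^ n * exp (-r cosh t)` over the positive half-line. -/
noncomputable def coshMoment (n : ℕ) (r : ℝ) : ℝ :=
  ∫ t in Ioi (0:ℝ), Real.cosh t ^ n * Real.exp (-(r * Real.cosh t))

/-! ### Modified Bessel functions of the first kind -/

lemma integral_cos_mul_exp_mul_sin_pow (k : ℕ) (r : ℝ) :
    ∫ θ in (0:ℝ)..Real.pi, Real.cos θ * Real.exp (r * Real.cos θ) * Real.sin θ ^ (2 * k)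
      = r / (2 * k + 1) * poissonIntegral (k + 1) r := by
  have hk : (2 * (k:ℝ) + 1) ≠ 0 := by positivity
  have hderiv : ∀ θ ∈ uIcc (0:ℝ) Real.pi, HasDerivAt
      (fun θ => Real.exp (r * Real.cos θ) * Real.sin θ ^ (2 * k + 1) / (2 * k + 1))
      (Real.cos θ * Real.exp (r * Real.cos θ) * Real.sin θ ^ (2 * k)
        - r / (2 * k + 1) * (Real.exp (r * Real.cos θ) * Real.sin θ ^ (2 * (k + 1)))) θ := by
    intro θ _
    have h := (((Real.hasDerivAt_cos θ).const_mul r).exp.mul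
      ((Real.hasDerivAt_sin θ).pow (2 * k + 1))).div_const (2 * (k:ℝ) + 1)
    refine h.congr_deriv ?_
    simp only [Pi.pow_apply, Nat.add_sub_cancel]
    push_cast
    field_simp
    ring
  have hintegral := intervalIntegral.integral_eq_sub_of_hasDerivAt hderiv
    (Continuous.intervalIntegrable (by fun_prop) _ _)
  rw [intervalIntegral.integral_sub (Continuous.intervalIntegrable (by fun_prop) _ _)
    (Continuous.intervalIntegrable (by fun_prop) _ _),
    intervalIntegral.integral_const_mul] at hintegral
  simp only [Real.sin_pi, Real.sin_zero, ne_eq, Nat.add_eq_zero_iff, one_ne_zero, and_false,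
    not_false_eq_true, zero_pow, mul_zero, zero_div, sub_zero] at hintegral
  exact sub_eq_zero.mp hintegral

lemma hasDerivAt_poissonIntegral (k : ℕ) (r : ℝ) :
    HasDerivAt (poissonIntegral k) (r / (2 * k + 1) * poissonIntegral (k + 1) r) r := by
  rw [← integral_cos_mul_exp_mul_sin_pow]
  refine (intervalIntegral.hasDerivAt_integral_of_dominated_loc_of_deriv_le
    (F := fun x θ => Real.exp (x * Real.cos θ) * Real.sin θ ^ (2 * k))
    (F' := fun x θ => Real.cos θ * Real.exp (x * Real.cos θ) * Real.sin θ ^ (2 * k))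
    (bound := fun _ => Real.exp (|r| + 1))
    (Metric.ball_mem_nhds r one_pos) ?_ ?_ ?_ ?_ ?_ ?_).2
  · exact Eventually.of_forall fun x => (by fun_prop : Continuous _).aestronglyMeasurable
  · exact Continuous.intervalIntegrable (by fun_prop) _ _
  · exact (by fun_prop : Continuous _).aestronglyMeasurable
  · refine Eventually.of_forall fun θ _ x hx => ?_
    have hx' : |x| ≤ |r| + 1 := by
      rw [Metric.mem_ball, Real.dist_eq] at hx
      have := abs_sub_abs_le_abs_sub x r
      linarith
    rw [Real.norm_eq_abs, abs_mul, abs_mul, abs_pow, Real.abs_exp]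
    have hc := Real.abs_cos_le_one θ
    have hs : |Real.sin θ| ^ (2 * k) ≤ 1 := pow_le_one₀ (abs_nonneg _) (Real.abs_sin_le_one θ)
    have he : Real.exp (x * Real.cos θ) ≤ Real.exp (|r| + 1) := by
      apply Real.exp_le_exp.mpr
      calc x * Real.cos θ ≤ |x| * |Real.cos θ| := by rw [← abs_mul]; exact le_abs_self _
        _ ≤ |x| * 1 := by gcongr
        _ ≤ _ := by linarith
    calc |Real.cos θ| * Real.exp (x * Real.cos θ) * |Real.sin θ| ^ (2 * k)
        ≤ 1 * Real.exp (|r| + 1) * 1 := by gcongr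
      _ = _ := by ring
  · exact intervalIntegrable_const
  · refine Eventually.of_forall fun θ _ x _ => ?_
    have h := (((hasDerivAt_id x).mul_const (Real.cos θ)).exp).mul_const (Real.sin θ ^ (2 * k))
    refine h.congr_deriv ?_
    simp only [id]
    ring

lemma continuous_poissonIntegral (k : ℕ) : Continuous (poissonIntegral k) :=
  continuous_iff_continuousAt.mpr fun r => (hasDerivAt_poissonIntegral k r).continuousAt

lemma poissonIntegral_recurrence (r : ℝ) :
    poissonIntegral 0 r - 2 * poissonIntegral 1 r = r ^ 2 / 3 * poissonIntegral 2 r := by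
  have hderiv : ∀ θ ∈ uIcc (0:ℝ) Real.pi, HasDerivAt
      (fun θ => Real.sin θ * Real.cos θ * Real.exp (r * Real.cos θ))
      (Real.exp (r * Real.cos θ) * Real.sin θ ^ (2 * 0)
        - 2 * (Real.exp (r * Real.cos θ) * Real.sin θ ^ (2 * 1))
        - r * (Real.cos θ * Real.exp (r * Real.cos θ) * Real.sin θ ^ (2 * 1))) θ := by
    intro θ _
    have h := ((Real.hasDerivAt_sin θ).mul (Real.hasDerivAt_cos θ)).mul
      ((Real.hasDerivAt_cos θ).const_mul r).exp
    refine h.congr_deriv ?_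
    simp only [Pi.mul_apply]
    linear_combination Real.exp (r * Real.cos θ) * Real.sin_sq_add_cos_sq θ
  have hintegral := intervalIntegral.integral_eq_sub_of_hasDerivAt hderiv
    (Continuous.intervalIntegrable (by fun_prop) _ _)
  rw [intervalIntegral.integral_sub (Continuous.intervalIntegrable (by fun_prop) _ _)
    (Continuous.intervalIntegrable (by fun_prop) _ _),
    intervalIntegral.integral_sub (Continuous.intervalIntegrable (by fun_prop) _ _)
    (Continuous.intervalIntegrable (by fun_prop) _ _),
    intervalIntegral.integral_const_mul, intervalIntegral.integral_const_mul,
    integral_cos_mul_exp_mul_sin_pow] at hintegral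
  change poissonIntegral 0 r - 2 * poissonIntegral 1 r - _ = _ at hintegral
  simp only [Real.sin_pi, Real.sin_zero] at hintegral
  norm_num at hintegral
  linear_combination hintegral

lemma integral_sin_pow_le_poissonIntegral (k : ℕ) (r : ℝ) :
    ∫ θ in (0:ℝ)..Real.pi, Real.sin θ ^ (2 * k) ≤ poissonIntegral k r := by
  have hzero := integral_cos_mul_exp_mul_sin_pow k 0
  simp only [zero_mul, Real.exp_zero, mul_one, zero_div] at hzero
  have hsplit : ∫ θ in (0:ℝ)..Real.pi, (Real.sin θ ^ (2 * k)
      + r * (Real.cos θ * Real.sin θ ^ (2 * k))) = ∫ θ in (0:ℝ)..Real.pi, Real.sin θ ^ (2 * k) := by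
    rw [intervalIntegral.integral_add (Continuous.intervalIntegrable (by fun_prop) _ _)
      (Continuous.intervalIntegrable (by fun_prop) _ _), intervalIntegral.integral_const_mul,
      hzero, mul_zero, add_zero]
  rw [← hsplit]
  refine intervalIntegral.integral_mono_on Real.pi_pos.le
    (Continuous.intervalIntegrable (by fun_prop) _ _)
    (Continuous.intervalIntegrable (by fun_prop) _ _) fun θ _ => ?_
  have h1 := Real.add_one_le_exp (r * Real.cos θ)
  have h2 : 0 ≤ Real.sin θ ^ (2 * k) := by rw [pow_mul]; positivity
  nlinarith [mul_le_mul_of_nonneg_right h1 h2]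

lemma poissonIntegral_pos (k : ℕ) (r : ℝ) : 0 < poissonIntegral k r :=
  (integral_sin_pow_pos (2 * k)).trans_le (integral_sin_pow_le_poissonIntegral k r)

lemma besselI_zero_eq (r : ℝ) : besselI 0 r = poissonIntegral 0 r / Real.pi := by
  have h : Real.Gamma ((0:ℕ) + 1 / 2) = √Real.pi := by
    rw [Nat.cast_zero, zero_add, Real.Gamma_one_half_eq]
  rw [besselI, h, Real.mul_self_sqrt Real.pi_pos.le, poissonIntegral]
  ring

lemma besselI_one_eq_s12 (r : ℝ) : besselI 1 r = r * poissonIntegral 1 r / Real.pi := by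
  have h : Real.Gamma ((1:ℕ) + 1 / 2) = √Real.pi / 2 := by
    rw [Nat.cast_one, add_comm, Real.Gamma_add_one (by norm_num), Real.Gamma_one_half_eq]
    ring
  rw [besselI, h, mul_div_assoc', Real.mul_self_sqrt Real.pi_pos.le, poissonIntegral]
  field_simp

lemma besselI_two_eq (r : ℝ) : besselI 2 r = r ^ 2 * poissonIntegral 2 r / (3 * Real.pi) := by
  have h : Real.Gamma ((2:ℕ) + 1 / 2) = √Real.pi * (3 / 4) := by
    rw [show (((2:ℕ) : ℝ) + 1 / 2) = (1 / 2 + 1) + 1 by norm_num,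
      Real.Gamma_add_one (by norm_num), Real.Gamma_add_one (by norm_num), Real.Gamma_one_half_eq]
    ring
  rw [besselI, h, ← mul_assoc, Real.mul_self_sqrt Real.pi_pos.le, poissonIntegral]
  field_simp
  ring

lemma continuous_besselI (k : ℕ) : Continuous (besselI k) := by
  have := continuous_poissonIntegral k
  change Continuous fun r => (r / 2) ^ k / _ * poissonIntegral k r
  fun_prop

lemma besselI_pos (k : ℕ) {r : ℝ} (hr : 0 < r) : 0 < besselI k r := by
  have h := poissonIntegral_pos k r
  have hG : 0 < Real.Gamma ((k:ℝ) + 1 / 2) := Real.Gamma_pos_of_pos (by positivity)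
  change 0 < (r / 2) ^ k / _ * poissonIntegral k r
  have := Real.pi_pos
  positivity

lemma besselI_two_recurrence {r : ℝ} (hr : r ≠ 0) :
    besselI 2 r = besselI 0 r - 2 * besselI 1 r / r := by
  rw [besselI_zero_eq, besselI_one_eq_s12, besselI_two_eq]
  have := Real.pi_ne_zero
  field_simp
  linear_combination -3 * poissonIntegral_recurrence r

lemma hasDerivAt_besselI_zero (r : ℝ) : HasDerivAt (besselI 0) (besselI 1 r) r := by
  rw [show besselI 0 = fun r => poissonIntegral 0 r / Real.pi from funext besselI_zero_eq]
  refine ((hasDerivAt_poissonIntegral 0 r).div_const Real.pi).congr_deriv ?_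
  rw [besselI_one_eq_s12]
  norm_num

lemma hasDerivAt_besselI_one {r : ℝ} (hr : r ≠ 0) :
    HasDerivAt (besselI 1) (besselI 0 r - besselI 1 r / r) r := by
  rw [show besselI 1 = fun r => r * poissonIntegral 1 r / Real.pi from funext besselI_one_eq_s12]
  refine (((hasDerivAt_id r).mul (hasDerivAt_poissonIntegral 1 r)).div_const Real.pi).congr_deriv ?_
  rw [besselI_zero_eq]
  have := Real.pi_ne_zero
  simp only [id]
  field_simp
  norm_num
  linear_combination -3 * poissonIntegral_recurrence r

lemma hasDerivAt_besselI_two {r : ℝ} (hr : r ≠ 0) :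
    HasDerivAt (besselI 2) (besselI 1 r - 2 * besselI 2 r / r) r := by
  have h := (hasDerivAt_besselI_zero r).sub
    (((hasDerivAt_besselI_one hr).const_mul 2).div (hasDerivAt_id r) hr)
  have heq : besselI 2 =ᶠ[𝓝 r] fun r => besselI 0 r - 2 * besselI 1 r / r := by
    filter_upwards [isOpen_ne.mem_nhds hr] with x hx using besselI_two_recurrence hx
  refine (h.congr_of_eventuallyEq heq).congr_deriv ?_
  rw [besselI_two_recurrence hr]
  simp only [id]
  field_simp
  ring

/-! ### Modified Bessel functions of the second kind -/

lemma cosh_pow_mul_exp_le (n : ℕ) {r t : ℝ} (hr : 0 < r) (ht : 0 ≤ t) :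
    Real.cosh t ^ n * Real.exp (-(r * Real.cosh t))
      ≤ n.factorial / (r / 2) ^ n * Real.exp (-(r / 2) * t) := by
  have hc : 0 < Real.cosh t := Real.cosh_pos t
  have hle : t ≤ Real.cosh t := (Real.self_le_sinh_iff.mpr ht).trans (Real.sinh_lt_cosh t).le
  have h1 := Real.pow_div_factorial_le_exp (r / 2 * Real.cosh t) (by positivity) n
  have h2 : Real.cosh t ^ n ≤ n.factorial / (r / 2) ^ n * Real.exp (r / 2 * Real.cosh t) := by
    have hf : (0:ℝ) < n.factorial := by positivity
    rw [mul_pow, div_le_iff₀ hf] at h1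
    rw [div_mul_eq_mul_div, le_div_iff₀ (by positivity)]
    linarith
  calc Real.cosh t ^ n * Real.exp (-(r * Real.cosh t))
      ≤ n.factorial / (r / 2) ^ n * Real.exp (r / 2 * Real.cosh t)
          * Real.exp (-(r * Real.cosh t)) := by gcongr
    _ = n.factorial / (r / 2) ^ n * Real.exp (-(r / 2) * Real.cosh t) := by
        rw [mul_assoc, ← Real.exp_add]; ring_nf
    _ ≤ _ := by
        gcongr ?_ * Real.exp ?_
        nlinarith

lemma integrableOn_cosh_pow_mul_exp (n : ℕ) {r : ℝ} (hr : 0 < r) :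
    IntegrableOn (fun t => Real.cosh t ^ n * Real.exp (-(r * Real.cosh t))) (Ioi 0) := by
  refine Integrable.mono' ((exp_neg_integrableOn_Ioi 0 (half_pos hr)).const_mul
    (n.factorial / (r / 2) ^ n)) (by fun_prop : Continuous _).aestronglyMeasurable ?_
  filter_upwards [ae_restrict_mem measurableSet_Ioi] with t ht
  have hc : 0 < Real.cosh t := Real.cosh_pos t
  rw [Real.norm_of_nonneg (by positivity)]
  exact cosh_pow_mul_exp_le n hr (le_of_lt ht)

lemma hasDerivAt_coshMoment (n : ℕ) {r : ℝ} (hr : 0 < r) :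
    HasDerivAt (coshMoment n) (-coshMoment (n + 1) r) r := by
  rw [coshMoment, ← integral_neg]
  refine (hasDerivAt_integral_of_dominated_loc_of_deriv_le
    (F := fun x t => Real.cosh t ^ n * Real.exp (-(x * Real.cosh t)))
    (F' := fun x t => -(Real.cosh t ^ (n + 1) * Real.exp (-(x * Real.cosh t))))
    (bound := fun t => Real.cosh t ^ (n + 1) * Real.exp (-(r / 2 * Real.cosh t)))
    (Ioi_mem_nhds (half_lt_self hr)) ?_ (integrableOn_cosh_pow_mul_exp n hr) ?_ ?_
    (integrableOn_cosh_pow_mul_exp (n + 1) (half_pos hr)) ?_).2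
  · exact Eventually.of_forall fun x => (by fun_prop : Continuous _).aestronglyMeasurable
  · exact (by fun_prop : Continuous _).aestronglyMeasurable
  · refine Eventually.of_forall fun t x hx => ?_
    have hc : 0 < Real.cosh t := Real.cosh_pos t
    rw [norm_neg, Real.norm_of_nonneg (by positivity)]
    have : r / 2 ≤ x := le_of_lt hx
    gcongr
  · refine Eventually.of_forall fun t x _ => ?_
    have h := (((hasDerivAt_id x).mul_const (Real.cosh t)).neg.exp).const_mul (Real.cosh t ^ n)
    refine h.congr_deriv ?_
    simp
    ring

lemma coshMoment_pos (n : ℕ) {r : ℝ} (hr : 0 < r) : 0 < coshMoment n r := by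
  refine setIntegral_pos_iff_support_of_nonneg_ae ?_ (integrableOn_cosh_pow_mul_exp n hr) |>.mpr ?_
  · exact Eventually.of_forall fun t => by
      have := Real.cosh_pos t
      simp only [Pi.zero_apply]
      positivity
  · have : Function.support (fun t => Real.cosh t ^ n * Real.exp (-(r * Real.cosh t))) = univ := by
      ext t
      have := Real.cosh_pos t
      simp only [Function.mem_support, mem_univ, iff_true]
      positivity
    simp [this]

lemma coshMoment_two {r : ℝ} (hr : 0 < r) :
    coshMoment 2 r = coshMoment 0 r + coshMoment 1 r / r := by
  have hderiv : ∀ t ∈ Ioi (0:ℝ), HasDerivAt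
      (fun t => Real.sinh t * Real.exp (-(r * Real.cosh t)))
      (Real.cosh t ^ 1 * Real.exp (-(r * Real.cosh t))
        - r * (Real.cosh t ^ 2 * Real.exp (-(r * Real.cosh t))
          - Real.cosh t ^ 0 * Real.exp (-(r * Real.cosh t)))) t := by
    intro t _
    have h := (Real.hasDerivAt_sinh t).mul ((Real.hasDerivAt_cosh t).const_mul r).neg.exp
    refine h.congr_deriv ?_
    simp only [Pi.neg_apply]
    linear_combination (r * Real.exp (-(r * Real.cosh t))) * Real.cosh_sq t
  have hlim : Tendsto (fun t => Real.sinh t * Real.exp (-(r * Real.cosh t))) atTop (𝓝 0) := by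
    have hexp : Tendsto (fun t => (Nat.factorial 1 : ℝ) / (r / 2) ^ 1 * Real.exp (-(r / 2) * t))
        atTop (𝓝 0) := by
      have h : Tendsto (fun t => Real.exp (-(r / 2) * t)) atTop (𝓝 0) :=
        Real.tendsto_exp_atBot.comp <| tendsto_id.const_mul_atTop_of_neg (by linarith)
      simpa only [mul_zero] using h.const_mul ((Nat.factorial 1 : ℝ) / (r / 2) ^ 1)
    refine squeeze_zero' ?_ ?_ hexp
    · filter_upwards [eventually_ge_atTop 0] with t ht
      have := Real.sinh_nonneg_iff.mpr ht
      positivity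
    · filter_upwards [eventually_ge_atTop 0] with t ht
      refine le_trans ?_ (cosh_pow_mul_exp_le 1 hr ht)
      rw [pow_one]
      gcongr
      exact (Real.sinh_lt_cosh t).le
  have hi := fun n => integrableOn_cosh_pow_mul_exp n hr
  have hintegral := integral_Ioi_of_hasDerivAt_of_tendsto
    (by fun_prop : Continuous _).continuousWithinAt hderiv
    ((hi 1).sub (((hi 2).sub (hi 0)).const_mul r)) hlim
  rw [integral_sub (hi 1) (by exact ((hi 2).sub (hi 0)).const_mul r), integral_const_mul,
    integral_sub (hi 2) (hi 0)] at hintegral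
  change coshMoment 1 r - r * (coshMoment 2 r - coshMoment 0 r) = _ at hintegral
  simp only [Real.sinh_zero, zero_mul, sub_zero] at hintegral
  field_simp
  linarith

lemma besselK_zero_eq : besselK 0 = coshMoment 0 := by
  funext r
  simp [besselK, coshMoment]

lemma besselK_one_eq : besselK 1 = coshMoment 1 := by
  funext r
  simp [besselK, coshMoment, mul_comm]

lemma besselK_zero_pos {r : ℝ} (hr : 0 < r) : 0 < besselK 0 r :=
  besselK_zero_eq ▸ coshMoment_pos 0 hr

lemma besselK_one_pos {r : ℝ} (hr : 0 < r) : 0 < besselK 1 r :=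
  besselK_one_eq ▸ coshMoment_pos 1 hr

lemma hasDerivAt_besselK_zero {r : ℝ} (hr : 0 < r) :
    HasDerivAt (besselK 0) (-besselK 1 r) r := by
  rw [besselK_zero_eq, besselK_one_eq]
  exact hasDerivAt_coshMoment 0 hr

lemma hasDerivAt_besselK_one {r : ℝ} (hr : 0 < r) :
    HasDerivAt (besselK 1) (-besselK 0 r - besselK 1 r / r) r := by
  rw [besselK_zero_eq, besselK_one_eq]
  refine (hasDerivAt_coshMoment 1 hr).congr_deriv ?_
  rw [coshMoment_two hr]
  ring

lemma besselK_zero_le_besselK_one {r : ℝ} (hr : 0 < r) : besselK 0 r ≤ besselK 1 r := by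
  rw [besselK_zero_eq, besselK_one_eq]
  refine integral_mono (integrableOn_cosh_pow_mul_exp 0 hr) (integrableOn_cosh_pow_mul_exp 1 hr)
    fun t => ?_
  simp only [pow_zero, pow_one]
  gcongr
  exact Real.one_le_cosh t

lemma integral_sinh_mul_exp {r : ℝ} (hr : 0 < r) :
    IntegrableOn (fun t => Real.sinh t * Real.exp (-(r * Real.cosh t))) (Ioi 0) ∧
    ∫ t in Ioi (0:ℝ), Real.sinh t * Real.exp (-(r * Real.cosh t)) = Real.exp (-r) / r := by
  have hderiv : ∀ t ∈ Ioi (0:ℝ), HasDerivAt (fun t => -Real.exp (-(r * Real.cosh t)) / r)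
      (Real.sinh t * Real.exp (-(r * Real.cosh t))) t := by
    intro t _
    have h := (((Real.hasDerivAt_cosh t).const_mul r).neg.exp.neg).div_const r
    refine h.congr_deriv ?_
    simp only [Pi.neg_apply]
    field_simp
  have hlim : Tendsto (fun t => -Real.exp (-(r * Real.cosh t)) / r) atTop (𝓝 0) := by
    have hcosh : Tendsto Real.cosh atTop atTop :=
      tendsto_atTop_mono' _ ((eventually_ge_atTop 0).mono fun t ht =>
        (Real.self_le_sinh_iff.mpr ht).trans (Real.sinh_lt_cosh t).le) tendsto_id
    have h := ((Real.tendsto_exp_neg_atTop_nhds_zero.comp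
      (hcosh.const_mul_atTop hr)).neg).div_const r
    simpa using h
  have hcont : ContinuousWithinAt (fun t => -Real.exp (-(r * Real.cosh t)) / r) (Ici 0) 0 :=
    (by fun_prop : Continuous _).continuousWithinAt
  have hintegral : IntegrableOn (fun t => Real.sinh t * Real.exp (-(r * Real.cosh t))) (Ioi 0) := by
    refine integrableOn_Ioi_deriv_of_nonneg hcont hderiv (fun t ht => ?_) hlim
    have := Real.sinh_nonneg_iff.mpr (le_of_lt ht)
    positivity
  refine ⟨hintegral, ?_⟩
  rw [integral_Ioi_of_hasDerivAt_of_tendsto hcont hderiv hintegral hlim]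
  simp
  ring

lemma tendsto_mul_besselK_one :
    Tendsto (fun r => r * besselK 1 r) (𝓝[>] 0) (𝓝 1) := by
  have hlower : Tendsto (fun r : ℝ => Real.exp (-r)) (𝓝[>] 0) (𝓝 1) := by
    have : Continuous fun r : ℝ => Real.exp (-r) := by fun_prop
    simpa using (this.tendsto 0).mono_left nhdsWithin_le_nhds
  have hupper : Tendsto (fun r : ℝ => Real.exp (-r) + r) (𝓝[>] 0) (𝓝 1) := by
    have : Continuous fun r : ℝ => Real.exp (-r) + r := by fun_prop
    simpa using (this.tendsto 0).mono_left nhdsWithin_le_nhds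
  refine tendsto_of_tendsto_of_tendsto_of_le_of_le' hlower hupper ?_ ?_
  · filter_upwards [self_mem_nhdsWithin] with r (hr : 0 < r)
    obtain ⟨hintegral, heq⟩ := integral_sinh_mul_exp hr
    have h : Real.exp (-r) / r ≤ besselK 1 r := by
      rw [← heq, besselK_one_eq]
      refine integral_mono hintegral (integrableOn_cosh_pow_mul_exp 1 hr) fun t => ?_
      simp only [pow_one]
      gcongr
      exact (Real.sinh_lt_cosh t).le
    rw [div_le_iff₀ hr] at h
    linarith
  · filter_upwards [self_mem_nhdsWithin] with r (hr : 0 < r)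
    obtain ⟨hintegral, heq⟩ := integral_sinh_mul_exp hr
    have hexp := exp_neg_integrableOn_Ioi 0 one_pos
    have h : besselK 1 r ≤ Real.exp (-r) / r + 1 := by
      have hone : ∫ t in Ioi (0:ℝ), Real.exp (-1 * t) = 1 := by
        simpa using integral_exp_neg_Ioi_zero
      rw [← heq, ← hone, ← integral_add hintegral hexp, besselK_one_eq]
      refine integral_mono (integrableOn_cosh_pow_mul_exp 1 hr) (hintegral.add hexp) fun t => ?_
      have hsub := Real.cosh_sub_sinh t
      have hle : Real.exp (-(r * Real.cosh t)) ≤ 1 :=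
        Real.exp_le_one_iff.mpr (by have := Real.cosh_pos t; nlinarith)
      have := mul_le_mul_of_nonneg_left hle (Real.exp_pos (-t)).le
      simp only [pow_one, neg_mul, one_mul]
      rw [← hsub] at this ⊢
      linarith
    calc r * besselK 1 r ≤ r * (Real.exp (-r) / r + 1) := by gcongr
      _ = _ := by field_simp

lemma tendsto_sq_mul_besselK_zero :
    Tendsto (fun r => r ^ 2 * besselK 0 r) (𝓝[>] 0) (𝓝 0) := by
  have hid : Tendsto (fun r : ℝ => r) (𝓝[>] 0) (𝓝 0) := tendsto_id.mono_left nhdsWithin_le_nhds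
  have hupper := hid.mul tendsto_mul_besselK_one
  rw [zero_mul] at hupper
  refine squeeze_zero' ?_ ?_ hupper
  · filter_upwards [self_mem_nhdsWithin] with r (hr : 0 < r)
    have := besselK_zero_pos hr
    positivity
  · filter_upwards [self_mem_nhdsWithin] with r (hr : 0 < r)
    rw [sq, mul_assoc]
    gcongr
    exact besselK_zero_le_besselK_one hr

lemma tendsto_besselK_zero_atTop : Tendsto (besselK 0) (𝓝[>] 0) atTop := by
  refine tendsto_atTop.mpr fun B => ?_
  set T := max (B * Real.exp 1) 0
  have hT : 0 ≤ T := le_max_right _ _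
  filter_upwards [Ioo_mem_nhdsGT (inv_pos.mpr (Real.cosh_pos T))] with r hr
  obtain ⟨hr0, hr1⟩ := hr
  have hbound : ∫ t in Ioc 0 T, Real.exp (-1) ≤ besselK 0 r := by
    have hi := integrableOn_cosh_pow_mul_exp 0 hr0
    rw [besselK_zero_eq]
    refine (setIntegral_mono_on (integrableOn_const (by simp)) (hi.mono_set Ioc_subset_Ioi_self)
      measurableSet_Ioc fun t ht => ?_).trans
      (setIntegral_mono_set hi ?_ Ioc_subset_Ioi_self.eventuallyLE)
    · rw [pow_zero, one_mul, Real.exp_le_exp, neg_le_neg_iff]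
      have hcosh : Real.cosh t ≤ Real.cosh T := by
        rw [Real.cosh_le_cosh, abs_of_pos ht.1, abs_of_nonneg hT]
        exact ht.2
      calc r * Real.cosh t ≤ (Real.cosh T)⁻¹ * Real.cosh T :=
            mul_le_mul hr1.le hcosh (Real.cosh_pos t).le (inv_pos.mpr (Real.cosh_pos T)).le
        _ = 1 := inv_mul_cancel₀ (Real.cosh_pos T).ne'
    · exact Eventually.of_forall fun t => by
        have := Real.cosh_pos t
        simp only [Pi.zero_apply]
        positivity
  refine le_trans ?_ hbound
  rw [setIntegral_const]
  simp only [measureReal_def, Real.volume_Ioc, sub_zero, smul_eq_mul, ENNReal.toReal_ofReal hT]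
  calc B = B * Real.exp 1 * Real.exp (-1) := by rw [mul_assoc, ← Real.exp_add]; simp
    _ ≤ T * Real.exp (-1) := by gcongr; exact le_max_left _ _

/-! ### Numerator and denominator of `Gfun` -/

/-- The Turán determinant in the denominator of `Gfun`. -/
noncomputable def turanI (r : ℝ) : ℝ := besselI 1 r ^ 2 - besselI 0 r * besselI 2 r

/-- The negated numerator of `Gfun`. -/
noncomputable def besselNumerator (r : ℝ) : ℝ :=
  1 - 2 * besselI 1 r * besselK 1 r - 2 * besselI 2 r * besselK 0 r

lemma Gfun_eq (r : ℝ) : Gfun r = 1 / (4 * Real.pi ^ 2) * (besselNumerator r / turanI r) := by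
  rw [Gfun, besselNumerator, turanI]
  ring

lemma pos_of_hasDerivAt_pos_of_tendsto_zero {f f' : ℝ → ℝ}
    (hf : ∀ x > 0, HasDerivAt f (f' x) x) (hpos : ∀ x > 0, 0 < f' x)
    (hlim : Tendsto f (𝓝[>] 0) (𝓝 0)) {r : ℝ} (hr : 0 < r) : 0 < f r := by
  have hmono : StrictMonoOn f (Ioi 0) := by
    refine strictMonoOn_of_deriv_pos (convex_Ioi 0)
      (fun x hx => (hf x hx).continuousAt.continuousWithinAt) fun x hx => ?_
    rw [interior_Ioi] at hx
    rw [(hf x hx).deriv]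
    exact hpos x hx
  have hhalf : 0 ≤ f (r / 2) := by
    refine le_of_tendsto hlim ?_
    filter_upwards [Ioo_mem_nhdsGT (half_pos hr)] with x hx
    exact (hmono hx.1 (half_pos hr) hx.2).le
  exact hhalf.trans_lt (hmono (half_pos hr) hr (half_lt_self hr))

lemma hasDerivAt_turanI {r : ℝ} (hr : 0 < r) :
    HasDerivAt turanI (2 * besselI 0 r * besselI 2 r / r) r := by
  have h := ((hasDerivAt_besselI_one hr.ne').pow 2).sub
    ((hasDerivAt_besselI_zero r).mul (hasDerivAt_besselI_two hr.ne'))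
  refine h.congr_deriv ?_
  rw [besselI_two_recurrence hr.ne']
  field_simp
  ring

lemma continuous_turanI : Continuous turanI := by
  have := continuous_besselI
  unfold turanI
  fun_prop

lemma turanI_pos {r : ℝ} (hr : 0 < r) : 0 < turanI r := by
  refine pos_of_hasDerivAt_pos_of_tendsto_zero (fun _ => hasDerivAt_turanI) (fun x hx => ?_) ?_ hr
  · have := besselI_pos 0 hx
    have := besselI_pos 2 hx
    positivity
  · have h0 : turanI 0 = 0 := by simp [turanI, besselI]
    simpa [h0] using (continuous_turanI.tendsto 0).mono_left
      (nhdsWithin_le_nhds (s := Ioi 0))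

lemma tendsto_turanI_atTop : Tendsto turanI atTop atTop := by
  set c := (∫ θ in (0:ℝ)..Real.pi, Real.sin θ ^ (2 * 0)) *
    (∫ θ in (0:ℝ)..Real.pi, Real.sin θ ^ (2 * 2)) / (3 * Real.pi ^ 2) with hc
  have hcpos : 0 < c := by
    have h0 := integral_sin_pow_pos (2 * 0)
    have h2 := integral_sin_pow_pos (2 * 2)
    have := Real.pi_pos
    positivity
  have hderiv : ∀ r > 0, HasDerivAt (fun r => turanI r - c / 2 * r ^ 2)
      (2 * besselI 0 r * besselI 2 r / r - c * r) r := by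
    intro r hr
    refine ((hasDerivAt_turanI hr).sub ((hasDerivAt_pow 2 r).const_mul (c / 2))).congr_deriv ?_
    norm_num
    ring
  have hpos : ∀ r > 0, 0 < 2 * besselI 0 r * besselI 2 r / r - c * r := by
    intro r hr
    have hprod : c ≤ poissonIntegral 0 r * poissonIntegral 2 r / (3 * Real.pi ^ 2) := by
      rw [hc]
      gcongr
      · exact (integral_sin_pow_pos _).le
      · exact (poissonIntegral_pos 0 r).le
      · exact integral_sin_pow_le_poissonIntegral 0 r
      · exact integral_sin_pow_le_poissonIntegral 2 r
    have heq : 2 * besselI 0 r * besselI 2 r / r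
        = 2 * (poissonIntegral 0 r * poissonIntegral 2 r / (3 * Real.pi ^ 2)) * r := by
      rw [besselI_zero_eq, besselI_two_eq]
      have := Real.pi_ne_zero
      field_simp
    rw [heq]
    nlinarith
  have hlim : Tendsto (fun r => turanI r - c / 2 * r ^ 2) (𝓝[>] 0) (𝓝 0) := by
    have hcont : Continuous fun r => turanI r - c / 2 * r ^ 2 := by
      have := continuous_turanI
      fun_prop
    simpa [turanI, besselI] using (hcont.tendsto 0).mono_left (nhdsWithin_le_nhds (s := Ioi 0))
  refine tendsto_atTop_mono' _ ?_
    ((tendsto_pow_atTop (two_ne_zero)).const_mul_atTop (half_pos hcpos))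
  filter_upwards [eventually_gt_atTop 0] with r hr
  have := pos_of_hasDerivAt_pos_of_tendsto_zero hderiv hpos hlim hr
  linarith

lemma hasDerivAt_besselNumerator {r : ℝ} (hr : 0 < r) :
    HasDerivAt besselNumerator (4 * besselI 2 r * besselK 0 r / r) r := by
  have h := ((((hasDerivAt_besselI_one hr.ne').const_mul 2).mul
    (hasDerivAt_besselK_one hr)).const_sub 1).sub
    (((hasDerivAt_besselI_two hr.ne').const_mul 2).mul (hasDerivAt_besselK_zero hr))
  refine h.congr_deriv ?_
  rw [besselI_two_recurrence hr.ne']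
  field_simp
  ring

lemma tendsto_besselNumerator_zero : Tendsto besselNumerator (𝓝[>] 0) (𝓝 0) := by
  have hone : poissonIntegral 1 0 = Real.pi / 2 := by
    have h := poissonIntegral_recurrence 0
    have h0 : poissonIntegral 0 0 = Real.pi := by simp [poissonIntegral]
    rw [h0] at h
    linarith
  have h1 := ((continuous_poissonIntegral 1).tendsto 0).mono_left
    (nhdsWithin_le_nhds (s := Ioi 0))
  have h2 := ((continuous_poissonIntegral 2).tendsto 0).mono_left
    (nhdsWithin_le_nhds (s := Ioi 0))
  have h := ((h1.mul tendsto_mul_besselK_one).const_mul (2 / Real.pi)).const_sub 1 |>.sub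
    ((h2.mul tendsto_sq_mul_besselK_zero).const_mul (2 / (3 * Real.pi)))
  have hpi := Real.pi_ne_zero
  convert h using 1
  · funext r
    rw [besselNumerator, besselI_one_eq_s12, besselI_two_eq]
    field_simp
  · rw [hone]
    congr 1
    field_simp
    ring

lemma besselK_zero_mul_turanI_lt {r : ℝ} (hr : 0 < r) :
    2 * besselK 0 r / besselI 0 r * turanI r < besselNumerator r := by
  have hderiv : ∀ r > 0, HasDerivAt
      (fun r => besselNumerator r - 2 * besselK 0 r / besselI 0 r * turanI r)
      (2 * turanI r * (besselK 1 r * besselI 0 r + besselK 0 r * besselI 1 r)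
        / besselI 0 r ^ 2) r := by
    intro r hr
    have hI := (besselI_pos 0 hr).ne'
    have h := (hasDerivAt_besselNumerator hr).sub
      ((((hasDerivAt_besselK_zero hr).const_mul 2).div (hasDerivAt_besselI_zero r) hI).mul
        (hasDerivAt_turanI hr))
    refine h.congr_deriv ?_
    simp only [Pi.div_apply]
    field_simp
    ring
  have hpos : ∀ r > 0, 0 < 2 * turanI r *
      (besselK 1 r * besselI 0 r + besselK 0 r * besselI 1 r) / besselI 0 r ^ 2 := by
    intro r hr
    have := turanI_pos hr
    have := besselK_zero_pos hr
    have := besselK_one_pos hr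
    have := besselI_pos 0 hr
    have := besselI_pos 1 hr
    positivity
  have hlim : Tendsto (fun r => besselNumerator r - 2 * besselK 0 r / besselI 0 r * turanI r)
      (𝓝[>] 0) (𝓝 0) := by
    have hA := fun k => ((continuous_poissonIntegral k).tendsto 0).mono_left
      (nhdsWithin_le_nhds (s := Ioi 0))
    have hq : Tendsto (fun r => 2 / Real.pi * (r ^ 2 * besselK 0 r) *
        ((poissonIntegral 1 r ^ 2 - poissonIntegral 0 r * poissonIntegral 2 r / 3)
          / poissonIntegral 0 r)) (𝓝[>] 0) (𝓝 0) := by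
      have h := (tendsto_sq_mul_besselK_zero.const_mul (2 / Real.pi)).mul
        ((((hA 1).pow 2).sub (((hA 0).mul (hA 2)).div_const 3)).div (hA 0)
          (poissonIntegral_pos 0 0).ne')
      simpa using h
    have h := tendsto_besselNumerator_zero.sub hq
    rw [sub_zero] at h
    refine h.congr fun r => ?_
    rw [turanI, besselI_zero_eq, besselI_one_eq_s12, besselI_two_eq]
    have := Real.pi_ne_zero
    have := (poissonIntegral_pos 0 r).ne'
    field_simp
  have := pos_of_hasDerivAt_pos_of_tendsto_zero hderiv hpos hlim hr
  linarith

lemma strictAntiOn_besselNumerator_div_turanI :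
    StrictAntiOn (fun r => besselNumerator r / turanI r) (Ioi 0) := by
  have hderiv : ∀ r > 0, HasDerivAt (fun r => besselNumerator r / turanI r) _ r := fun r hr =>
    (hasDerivAt_besselNumerator hr).div (hasDerivAt_turanI hr) (turanI_pos hr).ne'
  refine strictAntiOn_of_deriv_neg (convex_Ioi 0)
    (fun x hx => (hderiv x hx).continuousAt.continuousWithinAt) fun r hr => ?_
  rw [interior_Ioi] at hr
  have hr0 : 0 < r := hr
  rw [(hderiv r hr).deriv]
  have hD := turanI_pos hr
  have hI0 := besselI_pos 0 hr
  have hI2 := besselI_pos 2 hr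
  have hlt := besselK_zero_mul_turanI_lt hr
  refine div_neg_of_neg_of_pos ?_ (by positivity)
  have heq : 4 * besselI 2 r * besselK 0 r / r * turanI r
      - besselNumerator r * (2 * besselI 0 r * besselI 2 r / r)
      = (2 * besselI 0 r * besselI 2 r / r) *
        (2 * besselK 0 r / besselI 0 r * turanI r - besselNumerator r) := by
    field_simp
    ring
  rw [heq]
  exact mul_neg_of_pos_of_neg (by positivity) (by linarith)

lemma tendsto_besselNumerator_div_turanI_nhdsGT :
    Tendsto (fun r => besselNumerator r / turanI r) (𝓝[>] 0) atTop := by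
  have hI : Tendsto (fun r => 2 / besselI 0 r) (𝓝[>] 0) (𝓝 2) := by
    have h0 : besselI 0 0 = 1 := by
      rw [besselI_zero_eq]
      simp [poissonIntegral, Real.pi_ne_zero]
    have h := ((continuous_besselI 0).tendsto 0).mono_left (nhdsWithin_le_nhds (s := Ioi 0))
    rw [h0] at h
    simpa [div_eq_mul_inv] using (h.inv₀ one_ne_zero).const_mul 2
  refine tendsto_atTop_mono' _ ?_ (hI.pos_mul_atTop two_pos tendsto_besselK_zero_atTop)
  filter_upwards [self_mem_nhdsWithin] with r (hr : 0 < r)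
  rw [le_div_iff₀ (turanI_pos hr)]
  have := besselK_zero_mul_turanI_lt hr
  rw [div_mul_eq_mul_div 2]
  exact this.le

lemma tendsto_besselNumerator_div_turanI_atTop :
    Tendsto (fun r => besselNumerator r / turanI r) atTop (𝓝 0) := by
  refine squeeze_zero' ?_ ?_ (tendsto_inv_atTop_zero.comp tendsto_turanI_atTop)
  · filter_upwards [eventually_gt_atTop 0] with r hr
    have h := besselK_zero_mul_turanI_lt hr
    have hD := turanI_pos hr
    have := besselK_zero_pos hr
    have := besselI_pos 0 hr
    have hnonneg : 0 ≤ 2 * besselK 0 r / besselI 0 r * turanI r := by positivity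
    exact div_nonneg (hnonneg.trans h.le) hD.le
  · filter_upwards [eventually_gt_atTop 0] with r hr
    have hD := turanI_pos hr
    have := besselK_zero_pos hr
    have := besselK_one_pos hr
    have := besselI_pos 1 hr
    have := besselI_pos 2 hr
    have h1 : 0 ≤ 2 * besselI 1 r * besselK 1 r := by positivity
    have h2 : 0 ≤ 2 * besselI 2 r * besselK 0 r := by positivity
    rw [Function.comp_apply, ← one_div]
    gcongr
    rw [besselNumerator]
    linarith

theorem Gfun_strictAnti_and_limits :
    StrictAntiOn Gfun (Set.Ioi 0)
    ∧ Tendsto Gfun (nhdsWithin 0 (Set.Ioi 0)) atTop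
    ∧ Tendsto Gfun atTop (nhds 0) := by
  have hc : 0 < 1 / (4 * Real.pi ^ 2) := by have := Real.pi_pos; positivity
  rw [show Gfun = fun r => 1 / (4 * Real.pi ^ 2) * (besselNumerator r / turanI r) from
    funext Gfun_eq]
  refine ⟨fun x hx y hy hxy => ?_, ?_, ?_⟩
  · exact mul_lt_mul_of_pos_left (strictAntiOn_besselNumerator_div_turanI hx hy hxy) hc
  · exact tendsto_besselNumerator_div_turanI_nhdsGT.const_mul_atTop hc
  · rw [← mul_zero (1 / (4 * Real.pi ^ 2))]
    exact tendsto_besselNumerator_div_turanI_atTop.const_mul _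
end
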